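/- arXiv:2401.01225 — 8 statements merged into one kernel-verified Lean document; each statement's English description precedes it below -/
import Mathlib

section
/- For every real number ρ with 3/5 < ρ < 2/3, the complexity function of evolutionary stable configurations satisfies S^{ES}(ρ) = (2ρ−1)·ln(2ρ−1) − (2−3ρ)·ln(2−3ρ) − (5ρ−3)·ln(5ρ−3), where S^{ES}(ρ) is the supremum, over all sequences ((k_i, n_i))_{i∈ℕ} of pairs of nonnegative integers with n_i → ∞ and k_i/n_i → ρ, of limsup_{i→∞} ln(max(J^{ES}_{k_i,n_i}, 1))/n_i. -/
open Filter

/-- A configuration of length `n`: lots are indexed `1,…,n`; houses may only stand there. -/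
def InRange (n : ℕ) (c : ℕ → Bool) : Prop := ∀ i, c i = true → 1 ≤ i ∧ i ≤ n

/-- Lot `i` receives sunlight: it is a boundary lot, or one of its neighbours is empty. -/
def Sun (n : ℕ) (c : ℕ → Bool) (i : ℕ) : Prop :=
  i = 1 ∨ i = n ∨ c (i - 1) = false ∨ c (i + 1) = false

/-- Every occupied lot receives sunlight. -/
def Permissible (n : ℕ) (c : ℕ → Bool) : Prop := ∀ i, c i = true → Sun n c i

/-- The configuration obtained by occupying lot `j`. -/
def occupy (c : ℕ → Bool) (j : ℕ) : ℕ → Bool := fun i => if i = j then true else c i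

/-- Maximal (jammed): permissible, and occupying any empty lot breaks permissibility. -/
def IsMaximal (n : ℕ) (c : ℕ → Bool) : Prop :=
  Permissible n c ∧ ∀ j, 1 ≤ j → j ≤ n → c j = false → ¬ Permissible n (occupy c j)

/-- Resistant to predators: a house built on any empty lot would get no sunlight. -/
def ResistPred (n : ℕ) (c : ℕ → Bool) : Prop :=
  ∀ j, 1 ≤ j → j ≤ n → c j = false → ¬ Sun n (occupy c j) j

/-- Resistant to altruists: a house built on any empty lot would cut off sunlight
from some other occupied lot. -/
def ResistAlt (n : ℕ) (c : ℕ → Bool) : Prop :=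
  ∀ j, 1 ≤ j → j ≤ n → c j = false →
    ∃ i, i ≠ j ∧ c i = true ∧ ¬ Sun n (occupy c j) i

/-- Number of occupied lots. -/
def occ (n : ℕ) (c : ℕ → Bool) : ℕ :=
  ((Finset.Icc 1 n).filter (fun i => c i = true)).card

/-- `JES k n`: number of evolutionary stable configurations of length `n`
with `k` occupied lots. -/
noncomputable def JES (k n : ℕ) : ℕ :=
  Nat.card {c : ℕ → Bool //
    InRange n c ∧ IsMaximal n c ∧ ResistPred n c ∧ ResistAlt n c ∧ occ n c = k}

/-- The complexity function (configurational entropy) of a doubly indexed family of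
counts `J k n`, at density `ρ`. -/
noncomputable def complexity (J : ℕ → ℕ → ℕ) (ρ : ℝ) : ℝ :=
  sSup {L : ℝ | ∃ k n : ℕ → ℕ,
    Tendsto (fun i => (n i : ℝ)) atTop atTop ∧
    Tendsto (fun i => (k i : ℝ) / (n i : ℝ)) atTop (nhds ρ) ∧
    L = limsup (fun i => Real.log ((max (J (k i) (n i)) 1 : ℕ) : ℝ) / (n i : ℝ)) atTop}

def pre3 (c : ℕ → Bool) : ℕ → Bool
  | 0 => false
  | 1 => true
  | 2 => true
  | (i+3) => c i

def pre5 (c : ℕ → Bool) : ℕ → Bool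
  | 0 => false
  | 1 => true
  | 2 => false
  | 3 => true
  | 4 => true
  | (i+5) => c i

inductive EW : ℕ → ℕ → (ℕ → Bool) → Prop
  | nil : EW 0 0 (fun _ => false)
  | one : EW 0 1 (fun i => decide (i = 1))
  | p3 {a b c} : EW a b c → EW (a+1) b (pre3 c)
  | p5 {a b c} : EW a b c → EW (a+1) (b+1) (pre5 c)

structure RW (N : ℕ) (c : ℕ → Bool) : Prop where
  zero : c 0 = false
  out : ∀ i, N ≤ i → c i = false
  fst : 0 < N → c 1 = true
  lst : 0 < N → c (N - 1) = true
  gap : ∀ i, i + 1 < N → c (i+1) = false →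
    c i = true ∧ c (i+2) = true ∧ (c (i-1) = true ∨ c (i+3) = true)
  three : ∀ i, c i = true → c (i+1) = true → c (i+2) = true → False

lemma pre3_inj : Function.Injective pre3 := by
  intro c d h
  funext i
  exact congrFun h (i+3)

lemma pre5_inj : Function.Injective pre5 := by
  intro c d h
  funext i
  exact congrFun h (i+5)

lemma RW.pre3 {N c} (h : RW N c) : RW (N+3) (pre3 c) where
  zero := rfl
  out i hi := by
    obtain ⟨j, rfl⟩ : ∃ j, i = j + 3 := ⟨i - 3, by omega⟩
    exact h.out j (by omega)
  fst _ := rfl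
  lst _ := by
    rcases Nat.eq_zero_or_pos N with rfl | hN
    · rfl
    · obtain ⟨j, rfl⟩ : ∃ j, N = j + 1 := ⟨N - 1, by omega⟩
      exact h.lst hN
  gap i hi hc := by
    match i, hi, hc with
    | 0, _, hc => simp [_root_.pre3] at hc
    | 1, _, hc => simp [_root_.pre3] at hc
    | 2, hi, hc => exact ⟨rfl, h.fst (by omega), Or.inl rfl⟩
    | 3, hi, hc =>
      have h1 : c 1 = false := hc
      rw [h.fst (by omega)] at h1
      cases h1
    | (j+4), hi, hc => exact h.gap (j+1) (by omega) hc
  three i h1 h2 h3 := by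
    match i, h1, h2, h3 with
    | 0, h1, _, _ => simp [_root_.pre3] at h1
    | 1, _, _, h3 =>
      have h1 : c 0 = true := h3
      rw [h.zero] at h1; cases h1
    | 2, _, h3, _ =>
      have h1 : c 0 = true := h3
      rw [h.zero] at h1; cases h1
    | (j+3), h1, h2, h3 => exact h.three j h1 h2 h3

lemma RW.pre5 {N c} (h : RW N c) : RW (N+5) (pre5 c) where
  zero := rfl
  out i hi := by
    obtain ⟨j, rfl⟩ : ∃ j, i = j + 5 := ⟨i - 5, by omega⟩
    exact h.out j (by omega)
  fst _ := rfl
  lst _ := by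
    rcases Nat.eq_zero_or_pos N with rfl | hN
    · rfl
    · obtain ⟨j, rfl⟩ : ∃ j, N = j + 1 := ⟨N - 1, by omega⟩
      exact h.lst hN
  gap i hi hc := by
    match i, hi, hc with
    | 0, _, hc => simp [_root_.pre5] at hc
    | 1, _, hc => exact ⟨rfl, rfl, Or.inr rfl⟩
    | 2, _, hc => simp [_root_.pre5] at hc
    | 3, _, hc => simp [_root_.pre5] at hc
    | 4, hi, hc => exact ⟨rfl, h.fst (by omega), Or.inl rfl⟩
    | 5, hi, hc =>
      have h1 : c 1 = false := hc
      rw [h.fst (by omega)] at h1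
      cases h1
    | (j+6), hi, hc => exact h.gap (j+1) (by omega) hc
  three i h1 h2 h3 := by
    match i, h1, h2, h3 with
    | 0, h1, _, _ => simp [_root_.pre5] at h1
    | 1, _, h2, h3 => simp [_root_.pre5] at h2
    | 2, h1, h2, h3 => simp [_root_.pre5] at h1
    | 3, _, _, h3 =>
      have h1 : c 0 = true := h3
      rw [h.zero] at h1; cases h1
    | 4, _, h3, _ =>
      have h1 : c 0 = true := h3
      rw [h.zero] at h1; cases h1
    | (j+5), h1, h2, h3 => exact h.three j h1 h2 h3

lemma EW.spec {a b c} (h : EW a b c) :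
    RW (3*a+2*b) c ∧ Nat.count (fun i => c i = true) (3*a+2*b) = 2*a+b := by
  induction h with
  | nil => exact ⟨⟨rfl, fun _ _ => rfl, by simp, by simp, by simp, by simp⟩, by simp⟩
  | one =>
    refine ⟨⟨rfl, ?_, ?_, ?_, ?_, ?_⟩, ?_⟩
    · intro i hi; simp; omega
    · simp
    · simp
    · intro i hi;
      have : i = 0 := by omega
      subst this; simp
    · intro i h1 h2; simp at h1 h2; omega
    · simp [Nat.count_succ]
  | @p3 a b c _ ih =>
    have e : 3*(a+1)+2*b = 3*a+2*b+3 := by ring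
    rw [e]
    refine ⟨ih.1.pre3, ?_⟩
    rw [add_comm _ 3, Nat.count_add]
    have : (fun k => pre3 c (3+k) = true) = fun i => c i = true := by
      funext k; rw [add_comm]; rfl
    have e3 : Nat.count (fun i => pre3 c i = true) 3 = 2 := by
      repeat rw [Nat.count_succ]
      rw [Nat.count_zero]
      simp [pre3]
    simp only [this, ih.2, e3]
    ring
  | @p5 a b c _ ih =>
    have e : 3*(a+1)+2*(b+1) = 3*a+2*b+5 := by ring
    rw [e]
    refine ⟨ih.1.pre5, ?_⟩
    rw [add_comm _ 5, Nat.count_add]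
    have : (fun k => pre5 c (5+k) = true) = fun i => c i = true := by
      funext k; rw [add_comm]; rfl
    have e3 : Nat.count (fun i => pre5 c i = true) 5 = 3 := by
      repeat rw [Nat.count_succ]
      rw [Nat.count_zero]
      simp [pre5]
    simp only [this, ih.2, e3]
    ring

lemma RW.tail {N m c} (h : RW (N+m) c) (hm : 0 < m) (h0 : c m = false) : RW N (fun i => c (i+m)) := by
  have hf : 0 < N → c (1+m) = true := by
    intro hN
    obtain ⟨j, rfl⟩ : ∃ j, m = j + 1 := ⟨m - 1, by omega⟩
    have := (h.gap j (by omega) h0).2.1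
    rwa [show 1 + (j+1) = j+2 by ring]
  refine ⟨by simpa using h0, fun i hi => h.out _ (by omega), hf, ?_, ?_, ?_⟩
  · intro hN
    have := h.lst (by omega)
    show c (N - 1 + m) = true
    rwa [show N - 1 + m = N + m - 1 by omega]
  · intro i hi hc
    rcases Nat.eq_zero_or_pos i with rfl | hi0
    · have := hf (by omega)
      simp at hc; simp [hc] at this
    · have := h.gap (i+m) (by omega) (by rw [← hc]; congr 1; ring)
      show c (i+m) = true ∧ c (i+2+m) = true ∧ (c (i-1+m) = true ∨ c (i+3+m) = true)
      rwa [show i+2+m = i+m+2 by ring, show i-1+m = i+m-1 by omega, show i+3+m = i+m+3 by ring]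
  · intro i h1 h2 h3
    refine h.three (i+m) h1 ?_ ?_
    · rw [← h2]; congr 1; ring
    · rw [← h3]; congr 1; ring

lemma RW.exists {N : ℕ} : ∀ {c}, RW N c → ∃ a b, N = 3*a+2*b ∧ EW a b c := by
  induction N using Nat.strong_induction_on with
  | _ N ih =>
  intro c h
  rcases Nat.eq_zero_or_pos N with rfl | hN
  · refine ⟨0, 0, rfl, ?_⟩
    have : c = fun _ => false := funext fun i => h.out i (by omega)
    rw [this]; exact EW.nil
  have h1 := h.fst hN
  have lt : ∀ i, c i = true → i < N := by
    intro i hi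
    by_contra hh
    rw [h.out i (by omega)] at hi; cases hi
  have hN1 := lt 1 h1
  cases h2 : c 2 with
  | true =>
    have hN2 := lt 2 h2
    have h3 : c 3 = false := by
      cases h3 : c 3 with
      | false => rfl
      | true => exact (h.three 1 h1 h2 h3).elim
    obtain ⟨M, rfl⟩ : ∃ M, N = M + 3 := ⟨N - 3, by omega⟩
    obtain ⟨a, b, e, w⟩ := ih M (by omega) (h.tail (by norm_num) h3)
    refine ⟨a+1, b, by omega, ?_⟩
    have : c = _root_.pre3 (fun i => c (i+3)) := by
      funext i
      match i with
      | 0 => exact h.zero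
      | 1 => exact h1
      | 2 => exact h2
      | (j+3) => rfl
    rw [this]; exact EW.p3 w
  | false =>
    by_cases hN2 : N = 2
    · refine ⟨0, 1, by omega, ?_⟩
      have : c = fun i => decide (i = 1) := by
        funext i
        match i with
        | 0 => exact h.zero
        | 1 => exact h1
        | (j+2) => rw [h.out _ (by omega)]; simp
      rw [this]; exact EW.one
    · obtain ⟨-, h3, h4⟩ := h.gap 1 (by omega) h2
      have h4 : c 4 = true := by
        rcases h4 with h4 | h4
        · simp [h.zero] at h4
        · exact h4
      have hN4 := lt 4 h4
      have h5 : c 5 = false := by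
        cases h5 : c 5 with
        | false => rfl
        | true => exact (h.three 3 h3 h4 h5).elim
      obtain ⟨M, rfl⟩ : ∃ M, N = M + 5 := ⟨N - 5, by omega⟩
      obtain ⟨a, b, e, w⟩ := ih M (by omega) (h.tail (by norm_num) h5)
      refine ⟨a+1, b+1, by omega, ?_⟩
      have : c = _root_.pre5 (fun i => c (i+5)) := by
        funext i
        match i with
        | 0 => exact h.zero
        | 1 => exact h1
        | 2 => exact h2
        | 3 => exact h3
        | 4 => exact h4
        | (j+5) => rfl
      rw [this]; exact EW.p5 w

lemma EW.encard (a : ℕ) : ∀ b, Set.encard {c | EW a b c} = ((a+1).choose b : ℕ) := by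
  induction a with
  | zero =>
    intro b
    match b with
    | 0 =>
      have : {c | EW 0 0 c} = {fun _ => false} := by
        ext c; constructor
        · rintro ⟨⟩; rfl
        · rintro rfl; exact EW.nil
      rw [this]; simp
    | 1 =>
      have : {c | EW 0 1 c} = {fun i => decide (i = 1)} := by
        ext c; constructor
        · rintro ⟨⟩; rfl
        · rintro rfl; exact EW.one
      rw [this]; simp
    | (b+2) =>
      have : {c | EW 0 (b+2) c} = ∅ := by
        ext c; constructor
        · rintro ⟨⟩
        · rintro ⟨⟩
      rw [this, Nat.choose_eq_zero_of_lt (by omega)]; simp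
  | succ a ih =>
    intro b
    match b with
    | 0 =>
      have : {c | EW (a+1) 0 c} = pre3 '' {c | EW a 0 c} := by
        ext c; constructor
        · intro h
          cases h with
          | p3 w => exact ⟨_, w, rfl⟩
        · rintro ⟨d, w, rfl⟩; exact EW.p3 w
      rw [this, pre3_inj.encard_image, ih]; simp
    | (b+1) =>
      have : {c | EW (a+1) (b+1) c} = pre5 '' {c | EW a b c} ∪ pre3 '' {c | EW a (b+1) c} := by
        ext c; constructor
        · intro h
          cases h with
          | p3 w => exact Or.inr ⟨_, w, rfl⟩
          | p5 w => exact Or.inl ⟨_, w, rfl⟩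
        · rintro (⟨d, w, rfl⟩ | ⟨d, w, rfl⟩)
          · exact EW.p5 w
          · exact EW.p3 w
      rw [this, Set.encard_union_eq, pre3_inj.encard_image, pre5_inj.encard_image, ih, ih,
        Nat.choose_succ_succ (a+1)]
      · simp
      · rw [Set.disjoint_left]
        rintro _ ⟨d, w, rfl⟩ ⟨e, w2, h⟩
        have := congrFun h 2
        simp [pre3, pre5] at this

lemma RW_iff {n : ℕ} (hn : 1 ≤ n) (c : ℕ → Bool) :
    (InRange n c ∧ IsMaximal n c ∧ ResistPred n c ∧ ResistAlt n c) ↔ RW (n+1) c := by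
  constructor
  · rintro ⟨hr, ⟨hp, hm⟩, hpred, halt⟩
    have pr : ∀ j, 1 ≤ j → j ≤ n → c j = false → j ≠ 1 ∧ j ≠ n ∧ c (j-1) = true ∧ c (j+1) = true := by
      intro j a b hc
      have := hpred j a b hc
      unfold Sun occupy at this
      push Not at this
      obtain ⟨h1, h2, h3, h4⟩ := this
      rw [if_neg (by omega)] at h3 h4
      exact ⟨h1, h2, by simpa using h3, by simpa using h4⟩
    have z : c 0 = false := by
      by_contra h
      have := hr 0 (by simpa using h)
      omega
    have out : ∀ i, n+1 ≤ i → c i = false := by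
      intro i hi
      by_contra h
      have := hr i (by simpa using h)
      omega
    refine ⟨z, out, ?_, ?_, ?_, ?_⟩
    · intro _
      by_contra h
      exact (pr 1 le_rfl hn (by simpa using h)).1 rfl
    · intro _
      by_contra h
      exact (pr n hn le_rfl (by simpa using h)).2.1 rfl
    · intro i hi hc
      obtain ⟨h1, h2, h3, h4⟩ := pr (i+1) (by omega) (by omega) hc
      refine ⟨by simpa using h3, h4, ?_⟩
      obtain ⟨x, hx, hcx, hs⟩ := halt (i+1) (by omega) (by omega) hc
      have hs0 := hp x hcx
      unfold Sun occupy at hs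
      unfold Sun at hs0
      push Not at hs
      obtain ⟨s1, s2, s3, s4⟩ := hs
      have hx0 := hr x hcx
      by_cases e1 : x = i
      · subst e1
        left
        rw [if_neg (by omega)] at s3
        simpa using s3
      by_cases e2 : x = i + 2
      · subst e2
        right
        rw [if_neg (by omega)] at s4
        simpa using s4
      rw [if_neg (by omega)] at s3 s4
      tauto
    · intro i h1 h2 h3
      have r1 := hr _ h1
      have r3 := hr _ h3
      have := hp (i+1) h2
      unfold Sun at this
      rcases this with h | h | h | h
      · omega
      · omega
      · simp [h1] at h
      · simp [h3] at h
  · intro h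
    have hr : InRange n c := by
      intro i hi
      constructor
      · by_contra hh
        have : i = 0 := by omega
        subst this
        simp [h.zero] at hi
      · by_contra hh
        simp [h.out i (by omega)] at hi
    have hp : Permissible n c := by
      intro i hi
      have := hr i hi
      obtain ⟨j, rfl⟩ : ∃ j, i = j + 1 := ⟨i - 1, by omega⟩
      unfold Sun
      by_contra hh
      push Not at hh
      exact h.three j (by simpa using hh.2.2.1) hi (by simpa using hh.2.2.2)
    have hpred : ResistPred n c := by
      intro j a b hc
      obtain ⟨i, rfl⟩ : ∃ i, j = i + 1 := ⟨j - 1, by omega⟩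
      obtain ⟨h1, h2, h3⟩ := h.gap i (by omega) hc
      have hf := h.fst (by omega)
      have hl := h.lst (by omega)
      unfold Sun occupy
      push Not
      refine ⟨?_, ?_, ?_, ?_⟩
      · intro e; rw [e, hf] at hc; cases hc
      · intro e; rw [e] at hc; simp at hl; rw [hl] at hc; cases hc
      · simp [h1]
      · simp [h2]
    refine ⟨hr, ⟨hp, ?_⟩, hpred, ?_⟩
    · intro j a b hc hh
      exact hpred j a b hc (hh j (by simp [occupy]))
    · intro j a b hc
      obtain ⟨i, rfl⟩ : ∃ i, j = i + 1 := ⟨j - 1, by omega⟩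
      obtain ⟨h1, h2, h3⟩ := h.gap i (by omega) hc
      rcases h3 with h3 | h3
      · have r := hr _ h3
        refine ⟨i, by omega, h1, ?_⟩
        unfold Sun occupy
        push Not
        refine ⟨by omega, by omega, ?_, ?_⟩
        · simp [h3]
        · simp
      · have r := hr _ h3
        refine ⟨i+2, by omega, h2, ?_⟩
        unfold Sun occupy
        push Not
        refine ⟨by omega, by omega, ?_, ?_⟩
        · simp
        · simp [h3]

lemma occ_eq {n : ℕ} {c : ℕ → Bool} (h : c 0 = false) :
    occ n c = Nat.count (fun i => c i = true) (n+1) := by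
  rw [Nat.count_eq_card_filter_range, occ]
  congr 1
  ext i
  simp only [Finset.mem_filter, Finset.mem_Icc, Finset.mem_range]
  constructor
  · rintro ⟨h1, h2⟩; exact ⟨by omega, h2⟩
  · rintro ⟨h1, h2⟩
    refine ⟨⟨?_, by omega⟩, h2⟩
    by_contra hh
    have : i = 0 := by omega
    subst this
    simp [h] at h2

lemma JES_eq {k n : ℕ} (h1 : n < 2*k) (h2 : 3*k ≤ 2*n+2) :
    JES k n = (2*k-n).choose (2*n+2-3*k) := by
  obtain ⟨a, ha⟩ : ∃ a, 2*k-n = a+1 := ⟨2*k-n-1, by omega⟩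
  obtain ⟨b, hb⟩ : ∃ b, 2*n+2-3*k = b := ⟨_, rfl⟩
  have hset : {c : ℕ → Bool |
    InRange n c ∧ IsMaximal n c ∧ ResistPred n c ∧ ResistAlt n c ∧ occ n c = k} =
      {c | EW a b c} := by
    ext c
    have hn : n + 1 = 3*a+2*b := by omega
    simp only [Set.mem_ofPred_eq]
    constructor
    · rintro ⟨x1, x2, x3, x4, x5⟩
      have r := (RW_iff (by omega) c).1 ⟨x1, x2, x3, x4⟩
      obtain ⟨a', b', e, w⟩ := r.exists
      have := w.spec.2
      rw [← e, ← occ_eq r.zero, x5] at this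
      have ea : a' = a := by omega
      have eb : b' = b := by omega
      rwa [← ea, ← eb]
    · intro w
      obtain ⟨r, ct⟩ := w.spec
      rw [← hn] at r ct
      obtain ⟨x1, x2, x3, x4⟩ := (RW_iff (by omega) c).2 r
      refine ⟨x1, x2, x3, x4, ?_⟩
      rw [occ_eq r.zero, ct]; omega
  have : JES k n = Set.ncard {c : ℕ → Bool |
    InRange n c ∧ IsMaximal n c ∧ ResistPred n c ∧ ResistAlt n c ∧ occ n c = k} := rfl
  rw [this, hset, Set.ncard, EW.encard, ha, hb]
  simp

open Topology in
lemma fact_lim {n x : ℕ → ℕ} {α : ℝ} (hα : 0 < α)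
    (hn : Tendsto (fun i => (n i : ℝ)) atTop atTop)
    (hx : Tendsto (fun i => (x i : ℝ) / (n i : ℝ)) atTop (𝓝 α)) :
    Tendsto (fun i => Real.log ((x i).factorial : ℝ) / n i - (x i : ℝ) / n i * Real.log (n i))
      atTop (𝓝 (α * Real.log α - α)) := by
  have hpos : ∀ᶠ i in atTop, 0 < (n i : ℝ) := hn.eventually_gt_atTop 0
  have hxr : Tendsto (fun i => (x i : ℝ)) atTop atTop := by
    refine (hx.pos_mul_atTop hα hn).congr' ?_
    filter_upwards [hpos] with i hi
    field_simp
  have hxn : Tendsto x atTop atTop := tendsto_natCast_atTop_iff.1 hxr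
  have hinv : Tendsto (fun i => ((n i : ℝ))⁻¹) atTop (𝓝 0) := tendsto_inv_atTop_zero.comp hn
  have t1 : Tendsto (fun i => Real.log (Stirling.stirlingSeq (x i)) * (n i : ℝ)⁻¹) atTop (𝓝 0) := by
    have := ((Stirling.tendsto_stirlingSeq_sqrt_pi.comp hxn).log
      (by positivity)).mul hinv
    simpa using this
  have t2 : Tendsto (fun i => 1/2 * (Real.log (2 * x i) / (2 * x i) * (2 * ((x i : ℝ) / n i)))) atTop (𝓝 0) := by
    have h2x : Tendsto (fun i => 2 * (x i : ℝ)) atTop atTop := hxr.const_mul_atTop (by norm_num)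
    have l : Tendsto (fun y : ℝ => Real.log y / y) atTop (𝓝 0) :=
      Real.isLittleO_log_id_atTop.tendsto_div_nhds_zero
    have := ((l.comp h2x).mul (hx.const_mul 2)).const_mul (1/2)
    simpa using this
  have t3 : Tendsto (fun i => (x i : ℝ) / n i * (Real.log ((x i : ℝ) / n i) - 1)) atTop
      (𝓝 (α * (Real.log α - 1))) := hx.mul ((hx.log hα.ne').sub_const 1)
  have := (t1.add t2).add t3
  rw [show 0 + 0 + α * (Real.log α - 1) = α * Real.log α - α by ring] at this
  refine this.congr' ?_
  filter_upwards [hpos, hxr.eventually_gt_atTop 0] with i hi hxi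
  rw [Stirling.log_stirlingSeq_formula, Real.log_div hxi.ne' hi.ne',
    Real.log_div hxi.ne' (Real.exp_pos 1).ne', Real.log_exp]
  field_simp
  ring

open Topology in
lemma main_lim {ρ : ℝ} (h1 : 3 / 5 < ρ) (h2 : ρ < 2 / 3) {k n : ℕ → ℕ}
    (hn : Tendsto (fun i => (n i : ℝ)) atTop atTop)
    (hk : Tendsto (fun i => (k i : ℝ) / (n i : ℝ)) atTop (𝓝 ρ)) :
    Tendsto (fun i => Real.log ((max (JES (k i) (n i)) 1 : ℕ) : ℝ) / (n i : ℝ)) atTop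
      (𝓝 ((2 * ρ - 1) * Real.log (2 * ρ - 1) - (2 - 3 * ρ) * Real.log (2 - 3 * ρ)
        - (5 * ρ - 3) * Real.log (5 * ρ - 3))) := by
  have hpos : ∀ᶠ i in atTop, 0 < (n i : ℝ) := hn.eventually_gt_atTop 0
  have hinv : Tendsto (fun i => ((n i : ℝ))⁻¹) atTop (𝓝 0) := tendsto_inv_atTop_zero.comp hn
  have lA : Tendsto (fun i => 2 * ((k i : ℝ) / n i) - 1) atTop (𝓝 (2 * ρ - 1)) :=
    (hk.const_mul 2).sub_const 1
  have lB : Tendsto (fun i => 2 - 3 * ((k i : ℝ) / n i) + 2 * (n i : ℝ)⁻¹) atTop (𝓝 (2 - 3 * ρ)) := by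
    simpa using ((hk.const_mul 3).const_sub 2).add (hinv.const_mul 2)
  have lD : Tendsto (fun i => 5 * ((k i : ℝ) / n i) - 3 - 2 * (n i : ℝ)⁻¹) atTop (𝓝 (5 * ρ - 3)) := by
    simpa using ((hk.const_mul 5).sub_const 3).sub (hinv.const_mul 2)
  have ev : ∀ᶠ i in atTop, n i < 2 * k i ∧ 3 * k i ≤ 2 * n i + 2 ∧ 3 * n i + 2 ≤ 5 * k i := by
    filter_upwards [hpos, lA.eventually_const_lt (u := 0) (by linarith),
      lB.eventually_const_lt (u := 0) (by linarith),
      lD.eventually_const_lt (u := 0) (by linarith)] with i hi a b d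
    have a' := mul_pos a hi
    have b' := mul_pos b hi
    have d' := mul_pos d hi
    have e1 : (2 * ((k i : ℝ) / n i) - 1) * n i = 2 * k i - n i := by field_simp
    have e2 : (2 - 3 * ((k i : ℝ) / n i) + 2 * (n i : ℝ)⁻¹) * n i = 2 * n i - 3 * k i + 2 := by
      field_simp
    have e3 : (5 * ((k i : ℝ) / n i) - 3 - 2 * (n i : ℝ)⁻¹) * n i = 5 * k i - 3 * n i - 2 := by
      field_simp
    rw [e1] at a'
    rw [e2] at b'
    rw [e3] at d'
    refine ⟨?_, ?_, ?_⟩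
    · have : (n i : ℝ) < 2 * k i := by linarith
      exact_mod_cast this
    · have : (3 * k i : ℝ) ≤ 2 * n i + 2 := by linarith
      exact_mod_cast this
    · have : (3 * n i + 2 : ℝ) ≤ 5 * k i := by linarith
      exact_mod_cast this
  have fA := fact_lim (x := fun i => 2 * k i - n i) (α := 2 * ρ - 1) (by linarith) hn (by
    refine lA.congr' ?_
    filter_upwards [hpos, ev] with i hi e
    rw [Nat.cast_sub e.1.le]; push_cast; field_simp)
  have fB := fact_lim (x := fun i => 2 * n i + 2 - 3 * k i) (α := 2 - 3 * ρ) (by linarith) hn (by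
    refine lB.congr' ?_
    filter_upwards [hpos, ev] with i hi e
    rw [Nat.cast_sub e.2.1]; push_cast; field_simp; ring)
  have fD := fact_lim (x := fun i => 5 * k i - (3 * n i + 2)) (α := 5 * ρ - 3) (by linarith) hn (by
    refine lD.congr' ?_
    filter_upwards [hpos, ev] with i hi e
    rw [Nat.cast_sub e.2.2]; push_cast; field_simp; ring)
  have := (fA.sub fB).sub fD
  refine (this.congr' ?_).trans (le_of_eq ?_)
  · filter_upwards [hpos, ev] with i hi e
    obtain ⟨e1, e2, e3⟩ := e
    obtain ⟨B, hB⟩ : ∃ B, 2 * n i + 2 - 3 * k i = B := ⟨_, rfl⟩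
    obtain ⟨D, hD⟩ : ∃ D, 5 * k i - (3 * n i + 2) = D := ⟨_, rfl⟩
    have hA : 2 * k i - n i = B + D := by omega
    rw [JES_eq e1 e2, hA, hB, hD, max_eq_left (Nat.choose_pos (by omega)),
      Nat.cast_add_choose, Real.log_div (by positivity) (by positivity),
      Real.log_mul (by positivity) (by positivity)]
    push_cast
    ring
  · congr 1; ring

open Topology in
lemma stmt9_aux (ρ : ℝ) (h1 : 3 / 5 < ρ) (h2 : ρ < 2 / 3) :
    complexity JES ρ =
      (2 * ρ - 1) * Real.log (2 * ρ - 1) - (2 - 3 * ρ) * Real.log (2 - 3 * ρ)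
        - (5 * ρ - 3) * Real.log (5 * ρ - 3) := by
  unfold complexity
  refine Eq.trans (congrArg sSup ?_) (csSup_singleton _)
  ext L
  simp only [Set.mem_ofPred_eq, Set.mem_singleton_iff]
  constructor
  · rintro ⟨k, n, hn, hk, rfl⟩
    exact (main_lim h1 h2 hn hk).limsup_eq
  · rintro rfl
    have hn : Tendsto (fun i : ℕ => ((id i : ℕ) : ℝ)) atTop atTop := tendsto_natCast_atTop_atTop
    have hk : Tendsto (fun i : ℕ => ((⌊ρ * (i : ℝ)⌋₊ : ℕ) : ℝ) / ((id i : ℕ) : ℝ)) atTop (𝓝 ρ) :=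
      (tendsto_nat_floor_mul_div_atTop (by linarith : 0 ≤ ρ)).comp hn
    exact ⟨fun i => ⌊ρ * (i : ℝ)⌋₊, id, hn, hk, (main_lim h1 h2 hn hk).limsup_eq.symm⟩

/-- the complexity function of evolutionary stable configurations,
for `3/5 < ρ < 2/3`. -/
theorem stmt9 (ρ : ℝ) (h1 : 3 / 5 < ρ) (h2 : ρ < 2 / 3) :
    complexity JES ρ =
      (2 * ρ - 1) * Real.log (2 * ρ - 1) - (2 - 3 * ρ) * Real.log (2 - 3 * ρ)
        - (5 * ρ - 3) * Real.log (5 * ρ - 3) := by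
  exact stmt9_aux ρ h1 h2
end

section
/- There is no evolutionary stable configuration of length 3, while for every integer n ≥ 1 with n ≠ 3 there exists at least one evolutionary stable configuration of length n. -/
open Filter

/-- there is no evolutionary stable configuration of length `3`,
but there is one of every other length `n ≥ 1`. -/
theorem stmt10 :
    (¬ ∃ c : ℕ → Bool,
        InRange 3 c ∧ IsMaximal 3 c ∧ ResistPred 3 c ∧ ResistAlt 3 c) ∧
    ∀ n, 1 ≤ n → n ≠ 3 → ∃ c : ℕ → Bool,
        InRange n c ∧ IsMaximal n c ∧ ResistPred n c ∧ ResistAlt n c := by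
  constructor
  · rintro ⟨c, hin, ⟨hp, -⟩, hr, ha⟩
    have h1 : c 1 = true := by
      by_contra h
      exact hr 1 (by norm_num) (by norm_num) (by simpa using h) (Or.inl rfl)
    have h3 : c 3 = true := by
      by_contra h
      exact hr 3 (by norm_num) (by norm_num) (by simpa using h) (Or.inr (Or.inl rfl))
    have h2 : c 2 = false := by
      by_contra h
      have := hp 2 (by simpa using h)
      simp [Sun, h1, h3] at this
    obtain ⟨i, hi, hci, hs⟩ := ha 2 (by norm_num) (by norm_num) h2
    simp only [Sun, occupy, not_or] at hs
    obtain ⟨hi1, hi3, ha1, ha2⟩ := hs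
    have := hin i hci
    omega
  · intro n hn hn3
    have key : ∀ r : ℕ, (r = 0 ∧ n % 3 ≠ 0 ∨ r = 2 ∧ n % 3 = 0) → ∃ c : ℕ → Bool,
        InRange n c ∧ IsMaximal n c ∧ ResistPred n c ∧ ResistAlt n c := by
      intro r hr
      have hpred : ResistPred n (fun i => decide (1 ≤ i ∧ i ≤ n ∧ i % 3 ≠ r)) := by
        intro j h1 h2 h3
        simp only [Sun, occupy, decide_eq_false_iff_not] at *
        rw [if_neg (by omega), if_neg (by omega)]
        simp only [decide_eq_false_iff_not]
        omega
      refine ⟨fun i => decide (1 ≤ i ∧ i ≤ n ∧ i % 3 ≠ r), ?_, ⟨?_, ?_⟩, hpred, ?_⟩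
      · intro i hi
        simp only [decide_eq_true_eq] at hi
        omega
      · intro i hi
        simp only [Sun, decide_eq_true_eq, decide_eq_false_iff_not] at *
        omega
      · intro j h1 h2 h3 h
        exact hpred j h1 h2 h3 (h j (by simp [occupy]))
      · intro j h1 h2 h3
        simp only [Sun, occupy, decide_eq_true_eq, decide_eq_false_iff_not] at *
        by_cases hj : j = 2
        · refine ⟨3, by omega, by omega, ?_⟩
          subst hj
          simp only [decide_eq_false_iff_not]
          simp
          omega
        · refine ⟨j - 1, by omega, by omega, ?_⟩
          rw [if_neg (by omega), if_pos (by omega)]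
          simp only [decide_eq_false_iff_not]
          simp
          omega
    by_cases h : n % 3 = 0
    · exact key 2 (by omega)
    · exact key 0 (by omega)
end

section
/- For k ≥ 1 let Q_k denote the total number of evolutionary stable configurations (of any length n ≥ 1) with exactly k occupied lots; this number is finite since any such configuration with k occupied lots has length at most 2k−1. Then Q_1 = 1, Q_2 = 1, Q_3 = 2, and Q_k = Q_{k−2} + Q_{k−3} for all k ≥ 4 (i.e., the sequence (Q_k) satisfies the Padovan recurrence). -/
open Filter

/-- `Qk k`: the total number of evolutionary stable configurations (of any length
`n ≥ 1`) with exactly `k` occupied lots. -/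
noncomputable def Qk (k : ℕ) : ℕ :=
  Nat.card {p : ℕ × (ℕ → Bool) //
    1 ≤ p.1 ∧ InRange p.1 p.2 ∧ IsMaximal p.1 p.2 ∧ ResistPred p.1 p.2 ∧
      ResistAlt p.1 p.2 ∧ occ p.1 p.2 = k}

def EE (n : ℕ) (c : ℕ → Bool) : Prop :=
  (∀ i, c i = true → 1 ≤ i ∧ i ≤ n) ∧
  (∀ i, ¬ (c i = true ∧ c (i+1) = true ∧ c (i+2) = true)) ∧
  (∀ j, 1 ≤ j → j ≤ n → c j = false →
    c (j-1) = true ∧ c (j+1) = true ∧ (c (j-2) = true ∨ c (j+2) = true))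

theorem EE_iff (n : ℕ) (c : ℕ → Bool) :
    (InRange n c ∧ IsMaximal n c ∧ ResistPred n c ∧ ResistAlt n c) ↔ EE n c := by
  constructor
  · rintro ⟨hr, ⟨hp, -⟩, hpred, halt⟩
    refine ⟨hr, ?_, ?_⟩
    · rintro i ⟨h0, h1, h2⟩
      have a0 := hr _ h0
      have a2 := hr _ h2
      rcases hp _ h1 with h | h | h | h
      · omega
      · omega
      · simp at h; simp_all
      · simp_all
    · intro j j1 jn hj
      have h := hpred j j1 jn hj
      obtain ⟨i, hij, hi, hs⟩ := halt j j1 jn hj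
      simp only [Sun, occupy, not_or] at h hs
      have hri := hr i hi
      have e1 : j - 1 ≠ j := by omega
      have e2 : j + 1 ≠ j := by omega
      simp only [e1, e2, if_false, Bool.not_eq_false] at h
      refine ⟨h.2.2.1, h.2.2.2, ?_⟩
      have hpi := hp i hi
      simp only [Sun] at hpi
      by_cases c1 : i - 1 = j
      · have : i = j + 1 := by omega
        subst this
        have e3 : j + 1 + 1 ≠ j := by omega
        right
        simpa [e3] using hs.2.2.2
      · by_cases c2 : i + 1 = j
        · have : j - 2 = i - 1 := by omega
          left
          rw [this]
          simpa [c1] using hs.2.2.1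
        · simp only [c1, c2, if_false] at hs
          tauto
  · rintro ⟨hr, h3, hz⟩
    have alt : ResistAlt n c := by
      intro j j1 jn hj
      obtain ⟨a, b, d | d⟩ := hz j j1 jn hj
      · have r := hr _ d
        have r' := hr _ a
        refine ⟨j - 1, by omega, a, ?_⟩
        have e : j - 1 - 1 = j - 2 := by omega
        have e' : j - 1 + 1 = j := by omega
        have e2 : j - 2 ≠ j := by omega
        simp only [Sun, occupy, e, e', e2, if_true, if_false, d]
        simp; omega
      · have r := hr _ d
        refine ⟨j + 1, by omega, b, ?_⟩
        simp [Sun, occupy, d]; omega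
    refine ⟨hr, ⟨?_, ?_⟩, ?_, alt⟩
    · intro i hi
      have r := hr i hi
      have := h3 (i - 1)
      have e : i - 1 + 1 = i := by omega
      have e' : i - 1 + 2 = i + 1 := by omega
      rw [e, e'] at this
      unfold Sun
      cases h : c (i-1) <;> cases h' : c (i+1) <;> simp_all
    · intro j j1 jn hj hp
      obtain ⟨i, hij, hi, hs⟩ := alt j j1 jn hj
      exact hs (hp i (by simp [occupy, hi]))
    · intro j j1 jn hj
      obtain ⟨a, b, -⟩ := hz j j1 jn hj
      have r := hr _ a
      have r' := hr _ b
      have e : j - 1 ≠ j := by omega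
      simp [Sun, occupy, a, b, e]; omega

theorem occ_eq_s11 (n : ℕ) (c : ℕ → Bool) :
    occ n c = ∑ i ∈ Finset.range n, (if c (i+1) = true then 1 else 0) := by
  unfold occ
  rw [Finset.card_filter, Finset.range_eq_Ico, Finset.sum_Ico_add' (fun i => if c i = true then 1 else 0) 0 n 1]
  rfl

theorem occ_add (n m : ℕ) (c : ℕ → Bool) :
    occ (n + m) c = occ m c + occ n (fun i => c (i + m)) := by
  simp only [occ_eq_s11]
  rw [add_comm n m, Finset.sum_range_add]
  congr 1
  apply Finset.sum_congr rfl
  intro i _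
  rw [show m + i + 1 = i + 1 + m by omega]

theorem EE_shift (n m : ℕ) (c : ℕ → Bool) (h : EE (n + m) c) (hm : c m = false) :
    EE n (fun i => c (i + m)) := by
  obtain ⟨hr, h3, hz⟩ := h
  refine ⟨?_, ?_, ?_⟩
  · intro i hi
    have := hr _ hi
    have : i ≠ 0 := by rintro rfl; simp_all
    omega
  · intro i
    have := h3 (i + m)
    simp only
    rw [show i + 1 + m = i + m + 1 by omega, show i + 2 + m = i + m + 2 by omega]
    exact this
  · intro j j1 jn hj
    have := hz (j + m) (by omega) (by omega) hj
    simp only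
    rw [show j - 1 + m = j + m - 1 by omega, show j + 1 + m = j + m + 1 by omega,
      show j + 2 + m = j + m + 2 by omega]
    refine ⟨this.1, this.2.1, ?_⟩
    have j2 : 2 ≤ j := by
      by_contra hh
      have : j = 1 := by omega
      subst this
      rw [show 1 + m - 1 = m by omega] at this
      simp_all
    rw [show j - 2 + m = j + m - 2 by omega]
    exact this.2.2

def pre (m : ℕ) (w : ℕ → Bool) (p : ℕ × (ℕ → Bool)) : ℕ × (ℕ → Bool) :=
  (p.1 + m, fun i => if i ≤ m then w i else p.2 (i - m))

def w2 (i : ℕ) : Bool := decide (i = 1 ∨ i = 2)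
def w3 (i : ℕ) : Bool := decide (i = 1 ∨ i = 3 ∨ i = 4)

theorem pre_inj (m : ℕ) (w : ℕ → Bool) (p q : ℕ × (ℕ → Bool)) (hp : p.2 0 = false)
    (hq : q.2 0 = false) (h : pre m w p = pre m w q) : p = q := by
  obtain ⟨n, c⟩ := p
  obtain ⟨n', c'⟩ := q
  simp only [pre, Prod.mk.injEq] at h hp hq
  refine Prod.ext (by simp; omega) ?_
  funext i
  rcases Nat.eq_zero_or_pos i with rfl | hi
  · simp [hp, hq]
  · have := congrFun h.2 (i + m)
    simpa [show ¬ (i + m ≤ m) by omega] using this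

theorem EE_zero {n c} (h : EE n c) : c 0 = false := by
  by_contra h0
  have := h.1 0 (by simpa using h0)
  omega

theorem EE_one {n c} (h : EE n c) (hn : 1 ≤ n) : c 1 = true := by
  by_contra h0
  have := h.2.2 1 le_rfl hn (by simpa using h0)
  have := EE_zero h
  simp_all

theorem w2_occ (c : ℕ → Bool) (h : ∀ i ≤ 3, c i = w2 i) : occ 3 c = 2 := by
  simp only [occ_eq_s11, Finset.sum_range_succ]
  simp [h, w2]

theorem w3_occ (c : ℕ → Bool) (h : ∀ i ≤ 5, c i = w3 i) : occ 5 c = 3 := by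
  simp only [occ_eq_s11, Finset.sum_range_succ]
  simp [h, w3]

theorem EE_pre2 {n c} (h : EE n c) (hn : 1 ≤ n) :
    EE (n + 3) (pre 3 w2 (n, c)).2 := by
  have h0 := EE_zero h
  have h1 := EE_one h hn
  obtain ⟨hr, h3, hz⟩ := h
  simp only [pre]
  refine ⟨?_, ?_, ?_⟩
  · intro i hi
    simp only at hi
    split_ifs at hi with hh
    · simp [w2] at hi; omega
    · have := hr _ hi; omega
  · intro i
    rcases (by omega : i = 0 ∨ i = 1 ∨ i = 2 ∨ i = 3 ∨ 4 ≤ i) with rfl | rfl | rfl | rfl | hi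
    · simp [w2]
    · simp [w2]
    · simp [w2]
    · simp [w2]
    · have := h3 (i - 3)
      simpa [show ¬ i ≤ 3 by omega, show ¬ i + 1 ≤ 3 by omega, show ¬ i + 2 ≤ 3 by omega,
        show i + 1 - 3 = i - 3 + 1 by omega, show i + 2 - 3 = i - 3 + 2 by omega] using this
  · intro j j1 jn hj
    rcases (by omega : j = 1 ∨ j = 2 ∨ j = 3 ∨ j = 4 ∨ j = 5 ∨ 6 ≤ j) with
      rfl | rfl | rfl | rfl | rfl | hi
    · simp [w2] at hj
    · simp [w2] at hj
    · simp [w2, h1]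
    · simp [h1] at hj
    · have := hz 2 (by omega) (by omega) (by simpa using hj)
      simp [w2, h0] at this ⊢; tauto
    · have := hz (j - 3) (by omega) (by omega) (by simpa [show ¬ j ≤ 3 by omega] using hj)
      simpa [show ¬ j - 1 ≤ 3 by omega, show ¬ j + 1 ≤ 3 by omega, show ¬ j - 2 ≤ 3 by omega,
        show ¬ j + 2 ≤ 3 by omega, show j + 1 - 3 = j - 3 + 1 by omega,
        show j + 2 - 3 = j - 3 + 2 by omega, show j - 1 - 3 = j - 3 - 1 by omega,
        show j - 2 - 3 = j - 3 - 2 by omega] using this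

theorem EE_pre3 {n c} (h : EE n c) (hn : 1 ≤ n) :
    EE (n + 5) (pre 5 w3 (n, c)).2 := by
  have h0 := EE_zero h
  have h1 := EE_one h hn
  obtain ⟨hr, h3, hz⟩ := h
  simp only [pre]
  refine ⟨?_, ?_, ?_⟩
  · intro i hi
    simp only at hi
    split_ifs at hi with hh
    · simp [w3] at hi; omega
    · have := hr _ hi; omega
  · intro i
    rcases (by omega : i = 0 ∨ i = 1 ∨ i = 2 ∨ i = 3 ∨ i = 4 ∨ i = 5 ∨ 6 ≤ i) with
      rfl | rfl | rfl | rfl | rfl | rfl | hi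
    · simp [w3]
    · simp [w3]
    · simp [w3]
    · simp [w3]
    · simp [w3]
    · simp [w3]
    · have := h3 (i - 5)
      simpa [show ¬ i ≤ 5 by omega, show ¬ i + 1 ≤ 5 by omega, show ¬ i + 2 ≤ 5 by omega,
        show i + 1 - 5 = i - 5 + 1 by omega, show i + 2 - 5 = i - 5 + 2 by omega] using this
  · intro j j1 jn hj
    rcases (by omega : j = 1 ∨ j = 2 ∨ j = 3 ∨ j = 4 ∨ j = 5 ∨ j = 6 ∨ j = 7 ∨ 8 ≤ j) with
      rfl | rfl | rfl | rfl | rfl | rfl | rfl | hi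
    · simp [w3] at hj
    · simp [w3]
    · simp [w3] at hj
    · simp [w3] at hj
    · simp [w3, h1]
    · simp [h1] at hj
    · have := hz 2 (by omega) (by omega) (by simpa using hj)
      simp [w3, h0] at this ⊢; tauto
    · have := hz (j - 5) (by omega) (by omega) (by simpa [show ¬ j ≤ 5 by omega] using hj)
      simpa [show ¬ j - 1 ≤ 5 by omega, show ¬ j + 1 ≤ 5 by omega, show ¬ j - 2 ≤ 5 by omega,
        show ¬ j + 2 ≤ 5 by omega, show j + 1 - 5 = j - 5 + 1 by omega,
        show j + 2 - 5 = j - 5 + 2 by omega, show j - 1 - 5 = j - 5 - 1 by omega,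
        show j - 2 - 5 = j - 5 - 2 by omega] using this

theorem pre_occ (m : ℕ) (w : ℕ → Bool) (n : ℕ) (c : ℕ → Bool) :
    occ (n + m) (pre m w (n, c)).2 = occ m (pre m w (n, c)).2 + occ n c := by
  rw [occ_add]
  congr 1
  simp [occ_eq_s11, pre]

def SS (k : ℕ) : Set (ℕ × (ℕ → Bool)) := {p | 1 ≤ p.1 ∧ EE p.1 p.2 ∧ occ p.1 p.2 = k}

theorem Qk_eq (k : ℕ) : Qk k = (SS k).ncard := by
  unfold Qk
  rw [← Nat.card_coe_set_eq]
  apply Nat.card_congr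
  apply Equiv.subtypeEquivRight
  intro p
  have := EE_iff p.1 p.2
  simp only [SS, Set.mem_setOf_eq, ← this]
  tauto

def u1 : ℕ → Bool := fun i => decide (i = 1)

theorem decomp {n c} (h : EE n c) (hn : 1 ≤ n) :
    ((n, c) = (1, u1)) ∨ ((n, c) = (2, w2)) ∨ ((n, c) = (4, w3)) ∨
    (∃ p : ℕ × (ℕ → Bool), 1 ≤ p.1 ∧ EE p.1 p.2 ∧ (n, c) = pre 3 w2 p) ∨
    (∃ p : ℕ × (ℕ → Bool), 1 ≤ p.1 ∧ EE p.1 p.2 ∧ (n, c) = pre 5 w3 p) := by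
  have h0 := EE_zero h
  have h1 := EE_one h hn
  have hf : ∀ i, n < i → c i = false := by
    intro i hi
    by_contra hc
    have := h.1 i (by simpa using hc)
    omega
  have key : ∀ m (w : ℕ → Bool), c m = false → (∀ i ≤ m, c i = w i) → m + 1 ≤ n →
      (∃ p : ℕ × (ℕ → Bool), 1 ≤ p.1 ∧ EE p.1 p.2 ∧ (n, c) = pre m w p) := by
    intro m w hm hw hmn
    obtain ⟨n', rfl⟩ : ∃ n', n = n' + m := ⟨n - m, by omega⟩
    refine ⟨(n', fun i => c (i + m)), by simp; omega, EE_shift _ _ _ h hm, ?_⟩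
    simp only [pre]
    congr 1
    funext i
    split_ifs with hi
    · exact hw i hi
    · rw [show i - m + m = i by omega]
  cases h2 : c 2
  · by_cases n2 : 2 ≤ n
    · obtain ⟨-, c3, c4⟩ := h.2.2 2 (by omega) n2 h2
      simp only [Nat.reduceAdd, Nat.reduceSub, h0] at c3 c4
      have c4 : c 4 = true := by simpa using c4
      have n4 := (h.1 _ c4).2
      have c5 : c 5 = false := by
        have := h.2.1 3
        simpa [c3, c4] using this
      have hw : ∀ i ≤ 5, c i = w3 i := by
        intro i hi
        interval_cases i <;> simp [w3, *]
      by_cases n5 : 5 ≤ n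
      · have := h.2.2 5 (by omega) n5 c5
        have := h.1 _ this.2.1
        right; right; right; right
        exact key 5 w3 c5 hw (by omega)
      · right; right; left
        have : n = 4 := by omega
        subst this
        congr 1
        funext i
        by_cases hi : i ≤ 5
        · exact hw i hi
        · rw [hf i (by omega)]; symm; simp [w3]; omega
    · left
      have : n = 1 := by omega
      subst this
      congr 1
      funext i
      rcases (by omega : i = 0 ∨ i = 1 ∨ 1 < i) with rfl | rfl | hi
      · simp [h0, u1]
      · simp [h1, u1]
      · rw [hf i hi]; simp [u1]; omega
  · have n2 := (h.1 _ h2).2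
    have c3 : c 3 = false := by
      have := h.2.1 1
      simpa [h1, h2] using this
    have hw : ∀ i ≤ 3, c i = w2 i := by
      intro i hi
      interval_cases i <;> simp [w2, *]
    by_cases n3 : 3 ≤ n
    · have := h.2.2 3 (by omega) n3 c3
      have := h.1 _ this.2.1
      right; right; right; left
      exact key 3 w2 c3 hw (by omega)
    · right; left
      have : n = 2 := by omega
      subst this
      congr 1
      funext i
      by_cases hi : i ≤ 3
      · exact hw i hi
      · rw [hf i (by omega)]; symm; simp [w2]; omega

theorem occ_pre2 (p : ℕ × (ℕ → Bool)) : occ (pre 3 w2 p).1 (pre 3 w2 p).2 = 2 + occ p.1 p.2 := by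
  obtain ⟨n, c⟩ := p
  have := pre_occ 3 w2 n c
  rw [w2_occ (pre 3 w2 (n, c)).2 (by intro i hi; simp [pre, hi])] at this
  exact this

theorem occ_pre3 (p : ℕ × (ℕ → Bool)) : occ (pre 5 w3 p).1 (pre 5 w3 p).2 = 3 + occ p.1 p.2 := by
  obtain ⟨n, c⟩ := p
  have := pre_occ 5 w3 n c
  rw [w3_occ (pre 5 w3 (n, c)).2 (by intro i hi; simp [pre, hi])] at this
  exact this

theorem occ_u1 : occ 1 u1 = 1 := by simp [occ_eq_s11, u1]
theorem occ_w2 : occ 2 w2 = 2 := by decide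
theorem occ_w3 : occ 4 w3 = 3 := by decide

theorem bound_len : ∀ n c, EE n c → 1 ≤ n → n + 1 ≤ 2 * occ n c := by
  intro n
  induction n using Nat.strong_induction_on with
  | _ n ih =>
    intro c h hn
    rcases decomp h hn with e | e | e | ⟨p, hp, he, e⟩ | ⟨p, hp, he, e⟩
    · cases e; rw [occ_u1]
    · cases e; rw [occ_w2]; omega
    · cases e; rw [occ_w3]; omega
    · have h1 : n = p.1 + 3 := congrArg Prod.fst e
      have h2 := occ_pre2 p
      rw [← e] at h2
      have := ih p.1 (by omega) p.2 he hp
      simp only at h2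
      omega
    · have h1 : n = p.1 + 5 := congrArg Prod.fst e
      have h2 := occ_pre3 p
      rw [← e] at h2
      have := ih p.1 (by omega) p.2 he hp
      simp only at h2
      omega

theorem EE_u1 : EE 1 u1 := by
  refine ⟨?_, ?_, ?_⟩ <;> intro i <;> simp [u1] <;> omega

theorem EE_w2 : EE 2 w2 := by
  refine ⟨?_, ?_, ?_⟩ <;> intro i <;> simp [w2] <;> omega

theorem EE_w3 : EE 4 w3 := by
  refine ⟨?_, ?_, ?_⟩ <;> intro i <;> simp [w3] <;> omega

theorem mem_pre2 {k p} (h : p ∈ SS k) : pre 3 w2 p ∈ SS (k + 2) := by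
  obtain ⟨h1, h2, h3⟩ := h
  refine ⟨by simp [pre], EE_pre2 h2 h1, ?_⟩
  rw [occ_pre2, h3, add_comm]

theorem mem_pre3 {k p} (h : p ∈ SS k) : pre 5 w3 p ∈ SS (k + 3) := by
  obtain ⟨h1, h2, h3⟩ := h
  refine ⟨by simp [pre], EE_pre3 h2 h1, ?_⟩
  rw [occ_pre3, h3, add_comm]

theorem SS_pos {k p} (h : p ∈ SS k) : 1 ≤ k := by
  obtain ⟨h1, h2, h3⟩ := h
  have := bound_len _ _ h2 h1
  omega

theorem SS_cases {k p} (h : p ∈ SS k) :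
    (p = (1, u1) ∧ k = 1) ∨ (p = (2, w2) ∧ k = 2) ∨ (p = (4, w3) ∧ k = 3) ∨
    (∃ q l, q ∈ SS l ∧ k = l + 2 ∧ p = pre 3 w2 q) ∨
    (∃ q l, q ∈ SS l ∧ k = l + 3 ∧ p = pre 5 w3 q) := by
  obtain ⟨h1, h2, h3⟩ := h
  rcases decomp h2 h1 with e | e | e | ⟨q, hp, he, e⟩ | ⟨q, hp, he, e⟩
  · left; have e : p = (1, u1) := e; rw [← h3, e]; exact ⟨rfl, occ_u1⟩
  · right; left; have e : p = (2, w2) := e; rw [← h3, e]; exact ⟨rfl, occ_w2⟩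
  · right; right; left; have e : p = (4, w3) := e; rw [← h3, e]; exact ⟨rfl, occ_w3⟩
  · right; right; right; left
    have e : p = pre 3 w2 q := e
    refine ⟨q, _, ⟨hp, he, rfl⟩, ?_, e⟩
    rw [← h3, e, occ_pre2, add_comm]
  · right; right; right; right
    have e : p = pre 5 w3 q := e
    refine ⟨q, _, ⟨hp, he, rfl⟩, ?_, e⟩
    rw [← h3, e, occ_pre3, add_comm]

theorem SS_one : SS 1 = {(1, u1)} := by
  ext p
  constructor
  · intro h
    rcases SS_cases h with h | h | h | ⟨q, l, hq, hl, e⟩ | ⟨q, l, hq, hl, e⟩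
    · exact h.1
    all_goals omega
  · rintro rfl
    exact ⟨le_rfl, EE_u1, occ_u1⟩

theorem SS_two : SS 2 = {(2, w2)} := by
  ext p
  constructor
  · intro h
    rcases SS_cases h with h | h | h | ⟨q, l, hq, hl, e⟩ | ⟨q, l, hq, hl, e⟩
    · omega
    · exact h.1
    · omega
    · have := SS_pos hq; omega
    · omega
  · rintro rfl
    exact ⟨by simp, EE_w2, occ_w2⟩

theorem SS_three : SS 3 = {(4, w3), pre 3 w2 (1, u1)} := by
  ext p
  constructor
  · intro h
    rcases SS_cases h with h | h | h | ⟨q, l, hq, hl, e⟩ | ⟨q, l, hq, hl, e⟩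
    · omega
    · omega
    · left; exact h.1
    · have : l = 1 := by omega
      subst this
      rw [SS_one] at hq
      right; rw [e, hq]; rfl
    · have := SS_pos hq; omega
  · rintro (rfl | rfl)
    · exact ⟨by simp, EE_w3, occ_w3⟩
    · exact mem_pre2 (k := 1) (by rw [SS_one]; rfl)

theorem SS_rec (l : ℕ) (hl : 1 ≤ l) :
    SS (l + 3) = pre 3 w2 '' SS (l + 1) ∪ pre 5 w3 '' SS l := by
  ext p
  constructor
  · intro h
    rcases SS_cases h with h | h | h | ⟨q, l', hq, hl', e⟩ | ⟨q, l', hq, hl', e⟩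
    · omega
    · omega
    · omega
    · have : l' = l + 1 := by omega
      subst this
      exact Or.inl ⟨q, hq, e.symm⟩
    · have : l' = l := by omega
      subst this
      exact Or.inr ⟨q, hq, e.symm⟩
  · rintro (⟨q, hq, rfl⟩ | ⟨q, hq, rfl⟩)
    · exact mem_pre2 hq
    · exact mem_pre3 hq

theorem SS_fin (k : ℕ) : (SS k).Finite := by
  induction k using Nat.strong_induction_on with
  | _ k ih =>
    rcases (by omega : k = 0 ∨ k = 1 ∨ k = 2 ∨ k = 3 ∨ 4 ≤ k) with rfl | rfl | rfl | rfl | h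
    · convert Set.finite_empty
      ext p
      simp only [Set.mem_empty_iff_false, iff_false]
      intro h
      have := SS_pos h
      omega
    · rw [SS_one]; exact Set.finite_singleton _
    · rw [SS_two]; exact Set.finite_singleton _
    · rw [SS_three]; exact Set.toFinite _
    · obtain ⟨l, rfl⟩ : ∃ l, k = l + 3 := ⟨k - 3, by omega⟩
      rw [SS_rec l (by omega)]
      exact ((ih _ (by omega)).image _).union ((ih _ (by omega)).image _)

theorem SS_inj (m : ℕ) (w : ℕ → Bool) (k : ℕ) : Set.InjOn (pre m w) (SS k) := by
  intro p hp q hq h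
  exact pre_inj m w p q (EE_zero hp.2.1) (EE_zero hq.2.1) h

/-- any such configuration with `k ≥ 1` houses has length at most
`2k - 1`, and `(Q_k)` satisfies the Padovan recurrence. -/
theorem stmt11 :
    (∀ k, 1 ≤ k → ∀ n c, InRange n c → IsMaximal n c → ResistPred n c →
      ResistAlt n c → occ n c = k → n ≤ 2 * k - 1) ∧
    Qk 1 = 1 ∧ Qk 2 = 1 ∧ Qk 3 = 2 ∧ ∀ k, 4 ≤ k → Qk k = Qk (k - 2) + Qk (k - 3) := by
  refine ⟨?_, ?_, ?_, ?_, ?_⟩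
  · intro k hk n c h1 h2 h3 h4 h5
    have hE := (EE_iff n c).1 ⟨h1, h2, h3, h4⟩
    rcases Nat.eq_zero_or_pos n with rfl | hn
    · omega
    · have := bound_len n c hE hn
      omega
  · rw [Qk_eq, SS_one, Set.ncard_singleton]
  · rw [Qk_eq, SS_two, Set.ncard_singleton]
  · rw [Qk_eq, SS_three, Set.ncard_pair]
    intro h
    have := congrFun (congrArg Prod.snd h) 2
    simp [pre, w2, w3] at this
  · intro k hk
    obtain ⟨l, rfl⟩ : ∃ l, k = l + 3 := ⟨k - 3, by omega⟩
    rw [show l + 3 - 2 = l + 1 by omega, show l + 3 - 3 = l by omega]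
    simp only [Qk_eq]
    rw [SS_rec l (by omega), Set.ncard_union_eq ?_ ((SS_fin _).image _) ((SS_fin _).image _),
      Set.ncard_image_of_injOn (SS_inj _ _ _), Set.ncard_image_of_injOn (SS_inj _ _ _)]
    rw [Set.disjoint_left]
    rintro _ ⟨p, hp, rfl⟩ ⟨q, hq, h⟩
    have := congrFun (congrArg Prod.snd h) 2
    simp [pre, w2, w3] at this
end

section
/- Let C be a maximal configuration on an m×n grid (m ≥ 2) that is resistant to predators. Then the occupancy of the penultimate row (row m−1) is at most 2·⌈n/3⌉. -/
/-- Occupied lot `(i,j)` receives sunlight: the lot to its west, east or south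
lies outside the `m × n` grid or is empty. -/
def Sun2 (m n : ℕ) (C : ℕ → ℕ → Bool) (i j : ℕ) : Prop :=
  (j = 1 ∨ C i (j - 1) = false) ∨ (j = n ∨ C i (j + 1) = false) ∨
    (i = m ∨ C (i + 1) j = false)

/-- Every occupied lot of the `m × n` grid receives sunlight. -/
def Permissible2 (m n : ℕ) (C : ℕ → ℕ → Bool) : Prop :=
  ∀ i j, 1 ≤ i → i ≤ m → 1 ≤ j → j ≤ n → C i j = true → Sun2 m n C i j

/-- The configuration obtained by occupying lot `(i,j)`. -/
def occupy2 (C : ℕ → ℕ → Bool) (i j : ℕ) : ℕ → ℕ → Bool :=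
  fun a b => if a = i ∧ b = j then true else C a b

/-- Maximal: permissible, and occupying any empty lot breaks permissibility. -/
def IsMaximal2 (m n : ℕ) (C : ℕ → ℕ → Bool) : Prop :=
  Permissible2 m n C ∧ ∀ i j, 1 ≤ i → i ≤ m → 1 ≤ j → j ≤ n → C i j = false →
    ¬ Permissible2 m n (occupy2 C i j)

/-- Resistant to predators: a house built on any empty lot would get no sunlight. -/
def ResistPred2 (m n : ℕ) (C : ℕ → ℕ → Bool) : Prop :=
  ∀ i j, 1 ≤ i → i ≤ m → 1 ≤ j → j ≤ n → C i j = false →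
    ¬ Sun2 m n (occupy2 C i j) i j

/-- Resistant to altruists: a house built on any empty lot would cut off sunlight
from some other occupied lot. -/
def ResistAlt2 (m n : ℕ) (C : ℕ → ℕ → Bool) : Prop :=
  ∀ i j, 1 ≤ i → i ≤ m → 1 ≤ j → j ≤ n → C i j = false →
    ∃ a b, 1 ≤ a ∧ a ≤ m ∧ 1 ≤ b ∧ b ≤ n ∧ (a, b) ≠ (i, j) ∧ C a b = true ∧
      ¬ Sun2 m n (occupy2 C i j) a b

/-- Number of occupied lots in row `i`. -/
def rowOcc (n : ℕ) (C : ℕ → ℕ → Bool) (i : ℕ) : ℕ :=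
  ((Finset.Icc 1 n).filter (fun j => C i j = true)).card

/-- Total number of occupied lots. -/
def totalOcc (m n : ℕ) (C : ℕ → ℕ → Bool) : ℕ :=
  ∑ i ∈ Finset.Icc 1 m, rowOcc n C i

theorem count_aux (f : ℕ → Bool) (k : ℕ) : ∀ n, n ≤ 3 * k →
    (∀ j, 1 ≤ j → j + 2 ≤ n → f j = true → f (j + 1) = true → f (j + 2) = true → False) →
    ((Finset.Icc 1 n).filter (fun j => f j = true)).card ≤ 2 * k := by
  induction k with
  | zero =>
    intro n hn _
    have : n = 0 := by omega
    subst this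
    simp
  | succ k ih =>
    intro n hn h
    by_cases h3 : n ≤ 2
    · have h1 := Finset.card_filter_le (Finset.Icc 1 n) (fun j => f j = true)
      simp only [Nat.card_Icc] at h1
      omega
    · obtain ⟨t, rfl⟩ : ∃ t, n = t + 3 := ⟨n - 3, by omega⟩
      have h1 := ih t (by omega) (fun j a b => h j a (by omega))
      have h2 := h (t + 1) (by omega) (by omega)
      rw [Finset.card_filter] at h1 ⊢
      rw [Finset.sum_Icc_succ_top (by omega), Finset.sum_Icc_succ_top (by omega),
        Finset.sum_Icc_succ_top (by omega)]
      simp only [Nat.add_assoc, Nat.reduceAdd] at h2 ⊢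
      cases e1 : f (t + 1) <;> cases e2 : f (t + 2) <;> cases e3 : f (t + 3) <;>
        simp_all <;> omega

/-- the occupancy of the penultimate row of an `m × n` maximal
configuration resistant to predators is at most `2⌈n/3⌉`. -/
theorem stmt12 (m n : ℕ) (hm : 2 ≤ m) (C : ℕ → ℕ → Bool)
    (hmax : IsMaximal2 m n C) (hres : ResistPred2 m n C) :
    rowOcc n C (m - 1) ≤ 2 * ⌈(n : ℚ) / 3⌉₊ := by
  have hbot : ∀ j, 1 ≤ j → j ≤ n → C m j = true := by
    intro j h1 h2
    by_contra hc
    exact hres m j (by omega) le_rfl h1 h2 (by simpa using hc) (Or.inr (Or.inr (Or.inl rfl)))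
  apply count_aux (C (m - 1))
  · have h := Nat.le_ceil ((n : ℚ) / 3)
    have h' : (n : ℚ) ≤ 3 * (⌈(n : ℚ) / 3⌉₊ : ℚ) := by linarith
    exact_mod_cast h'
  · intro j h1 h2 a b c
    have hb := hbot (j + 1) (by omega) (by omega)
    have hs := hmax.1 (m - 1) (j + 1) (by omega) (by omega) (by omega) (by omega) b
    have hm1 : m - 1 + 1 = m := by omega
    unfold Sun2 at hs
    rw [hm1, Nat.add_sub_cancel, a, hb, show j + 1 + 1 = j + 2 from rfl, c] at hs
    simp at hs
    omega
end

section
/- Let C be a maximal configuration on an m×n grid (m ≥ 2) that is resistant to predators, and suppose the occupancy of the penultimate row (row m−1) equals r. Then for every row index i with 1 ≤ i ≤ m−2, the occupancy of row i is at most r+1. -/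
/-- number of empty lots among columns `1..k` -/
def zc (f : ℕ → Bool) : ℕ → ℤ
  | 0 => 0
  | k + 1 => zc f k + (if f (k + 1) = true then 0 else 1)

/-- indicator of emptiness -/
def zi (f : ℕ → Bool) (k : ℕ) : ℤ := if f k = true then 0 else 1

theorem zc_succ (f : ℕ → Bool) (k : ℕ) : zc f (k + 1) = zc f k + zi f (k + 1) := rfl

theorem zi_t {f : ℕ → Bool} {k : ℕ} (h : f k = true) : zi f k = 0 := by simp [zi, h]
theorem zi_f {f : ℕ → Bool} {k : ℕ} (h : f k = false) : zi f k = 1 := by simp [zi, h]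

theorem rowOcc_zc (C : ℕ → ℕ → Bool) (i n : ℕ) : (rowOcc n C i : ℤ) + zc (C i) n = n := by
  induction n with
  | zero => simp [rowOcc, zc]
  | succ k ih =>
    have : rowOcc (k + 1) C i = rowOcc k C i + (if C i (k + 1) = true then 1 else 0) := by
      unfold rowOcc
      rw [← Finset.insert_Icc_right_eq_Icc_add_one (by omega), Finset.filter_insert]
      split_ifs with h
      · rw [Finset.card_insert_of_notMem (by simp)]
      · rfl
    rw [this, zc]
    split_ifs <;> push_cast <;> linarith

theorem inv_lem (n : ℕ) (a b : ℕ → Bool)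
    (ha : ∀ j, 1 ≤ j → j ≤ n → a j = false → 2 ≤ j ∧ j + 1 ≤ n ∧ a (j - 1) = true ∧ a (j + 1) = true)
    (hb : ∀ j, 1 ≤ j → j ≤ n → b j = false → 2 ≤ j ∧ j + 1 ≤ n ∧ b (j - 1) = true ∧ b (j + 1) = true
      ∧ a j = true)
    (hs : ∀ j, 2 ≤ j → j + 1 ≤ n → b (j - 1) = true → b j = true → b (j + 1) = true → a j = false)
    (d : ℕ) : d + 2 ≤ n →
      -1 ≤ 2 * (zc b (d + 2) - zc a (d + 2)) + zi a 2 - zi b 2 ∧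
      (a (d + 2) = true → (b (d + 2) = false ∨ a (d + 1) = true) → (d = 0 → b 2 = false) →
        1 ≤ 2 * (zc b (d + 2) - zc a (d + 2)) + zi a 2 - zi b 2) := by
  induction d with
  | zero =>
    intro h
    have a1 : a 1 = true := by
      by_contra h1
      have := ha 1 (by omega) (by omega) (by simpa using h1)
      omega
    have b1 : b 1 = true := by
      by_contra h1
      have := hb 1 (by omega) (by omega) (by simpa using h1)
      omega
    have hb2 := hb 2 (by omega) (by omega)
    cases h2 : a 2 <;> cases h3 : b 2 <;> simp_all [zc, zi]
  | succ d ih =>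
    intro h
    obtain ⟨i1, i2⟩ := ih (by omega)
    have ha1 := ha (d + 3) (by omega) (by omega)
    have hb1 := hb (d + 3) (by omega) (by omega)
    have ha2 := ha (d + 2) (by omega) (by omega)
    have hb2 := hb (d + 2) (by omega) (by omega)
    have ha0 := ha (d + 1) (by omega) (by omega)
    have hb0 := hb (d + 1) (by omega) (by omega)
    have hs1 := hs (d + 2) (by omega) (by omega)
    have e1 : d + 3 - 1 = d + 2 := by omega
    have e2 : d + 2 - 1 = d + 1 := by omega
    have e3 : d + 1 + 2 = d + 3 := by omega
    have e4 : d + 1 + 1 = d + 2 := by omega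
    have e5 : d + 2 + 1 = d + 3 := by omega
    have e0 : d = 0 → d + 1 = 1 := by omega
    rw [e3, e4, zc_succ b (d + 2), zc_succ a (d + 2)]
    simp only [e1, e2, e5, e4] at *
    have hd : d = 0 → b 2 = b (d + 2) := by rintro rfl; rfl
    by_cases p1 : a (d + 3) = false
    · have q := ha1 p1
      have p2 : b (d + 3) = true := by grind
      rw [zi_f p1, zi_t p2]
      have := i2 (by grind) (by grind) (by grind)
      constructor
      · linarith
      · grind
    · have p1 : a (d + 3) = true := by simpa using p1
      by_cases p2 : b (d + 3) = false
      · rw [zi_t p1, zi_f p2]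
        constructor
        · linarith
        · intros; linarith
      · have p2 : b (d + 3) = true := by simpa using p2
        rw [zi_t p1, zi_t p2]
        constructor
        · linarith
        · intro _ h4 _
          have := i2 (by grind) (by grind) (by grind)
          linarith

theorem step_lem (n : ℕ) (hn : 3 ≤ n) (a b : ℕ → Bool)
    (ha : ∀ j, 1 ≤ j → j ≤ n → a j = false → 2 ≤ j ∧ j + 1 ≤ n ∧ a (j - 1) = true ∧ a (j + 1) = true)
    (hb : ∀ j, 1 ≤ j → j ≤ n → b j = false → 2 ≤ j ∧ j + 1 ≤ n ∧ b (j - 1) = true ∧ b (j + 1) = true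
      ∧ a j = true)
    (hs : ∀ j, 2 ≤ j → j + 1 ≤ n → b (j - 1) = true → b j = true → b (j + 1) = true → a j = false) :
    2 * zc a n - zi a 2 - zi a (n - 1) ≤ 2 * zc b n - zi b 2 - zi b (n - 1) := by
  obtain ⟨d, rfl⟩ : ∃ d, n = d + 3 := ⟨n - 3, by omega⟩
  obtain ⟨i1, i2⟩ := inv_lem (d + 3) a b ha hb hs (d + 1) (by omega)
  have e3 : d + 1 + 2 = d + 3 := by omega
  have e4 : d + 1 + 1 = d + 2 := by omega
  have e5 : d + 3 - 1 = d + 2 := by omega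
  rw [e3] at i1 i2
  rw [e4] at i2
  rw [e5]
  have an : a (d + 3) = true := by
    by_contra h1
    have := ha (d + 3) (by omega) (by omega) (by simpa using h1)
    omega
  by_cases p : a (d + 2) = true
  · have := i2 an (Or.inr p) (by omega)
    have : zi b (d + 2) ≤ 1 := by unfold zi; split_ifs <;> norm_num
    rw [zi_t p]; linarith
  · have p : a (d + 2) = false := by simpa using p
    have q : b (d + 2) = true := by
      by_contra h1
      have := hb (d + 2) (by omega) (by omega) (by simpa using h1)
      simp_all
    rw [zi_f p, zi_t q]; linarith

theorem stmt13 (m n : ℕ) (hm : 2 ≤ m) (C : ℕ → ℕ → Bool)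
    (hmax : IsMaximal2 m n C) (hres : ResistPred2 m n C)
    (r : ℕ) (hr : rowOcc n C (m - 1) = r) :
    ∀ i, 1 ≤ i → i ≤ m - 2 → rowOcc n C i ≤ r + 1 := by
  have key : ∀ i j, 1 ≤ i → i ≤ m → 1 ≤ j → j ≤ n → C i j = false →
      2 ≤ j ∧ j + 1 ≤ n ∧ C i (j - 1) = true ∧ C i (j + 1) = true ∧ C (i + 1) j = true := by
    intro i j h1 h2 h3 h4 h5
    have h := hres i j h1 h2 h3 h4 h5
    have n1 : j - 1 ≠ j := by omega
    simp [Sun2, occupy2, n1] at h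
    obtain ⟨⟨g1, g2⟩, ⟨g3, g4⟩, g5, g6⟩ := h
    exact ⟨by omega, by omega, g2, g4, g6⟩
  intro i hi1 hi2
  have ri := rowOcc_zc C i n
  have rm := rowOcc_zc C (m - 1) n
  rw [hr] at rm
  by_cases hn : 3 ≤ n
  · have step : ∀ i, 1 ≤ i → i + 1 ≤ m →
        2 * zc (C (i + 1)) n - zi (C (i + 1)) 2 - zi (C (i + 1)) (n - 1)
          ≤ 2 * zc (C i) n - zi (C i) 2 - zi (C i) (n - 1) := by
      intro i h1 h2
      apply step_lem n hn
      · intro j g1 g2 g3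
        have := key (i + 1) j (by omega) h2 g1 g2 g3
        tauto
      · intro j g1 g2 g3
        exact key i j h1 (by omega) g1 g2 g3
      · intro j g1 g2 g3 g4 g5
        have := hmax.1 i j h1 (by omega) (by omega) (by omega) g4
        have n1 : j ≠ 1 := by omega
        have n2 : j ≠ n := by omega
        have n3 : i ≠ m := by omega
        simpa [Sun2, g3, g5, n1, n2, n3] using this
    have chain : ∀ d, i + d ≤ m →
        2 * zc (C (i + d)) n - zi (C (i + d)) 2 - zi (C (i + d)) (n - 1)
          ≤ 2 * zc (C i) n - zi (C i) 2 - zi (C i) (n - 1) := by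
      intro d
      induction d with
      | zero => intro _; exact le_refl _
      | succ d ih =>
        intro h
        exact (step (i + d) (by omega) (by omega)).trans (ih (by omega))
    have c := chain (m - 1 - i) (by omega)
    rw [show i + (m - 1 - i) = m - 1 by omega] at c
    have z1 : ∀ f k, zi f k ≤ 1 := by intro f k; unfold zi; split_ifs <;> norm_num
    have z0 : ∀ f k, 0 ≤ zi f k := by intro f k; unfold zi; split_ifs <;> norm_num
    have := z1 (C (m - 1)) 2
    have := z1 (C (m - 1)) (n - 1)
    have := z0 (C i) 2
    have := z0 (C i) (n - 1)
    omega
  · have : r = n := by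
      rw [← hr, rowOcc, Finset.filter_true_of_mem]
      · simp
      · intro j hj
        rw [Finset.mem_Icc] at hj
        by_contra h
        have := key (m - 1) j (by omega) (by omega) hj.1 hj.2 (by simpa using h)
        omega
    have : rowOcc n C i ≤ n := by
      unfold rowOcc
      exact (Finset.card_filter_le _ _).trans (by simp)
    omega
end

section
/- Let C be an evolutionary stable configuration on an m×n grid with 3 dividing n, and suppose that for some row index i₀ with 3 ≤ i₀ ≤ m, row i₀ equals the full-width periodic pattern 101 101 … 101, i.e., C_{i₀,j} = 0 if and only if j ≡ 2 (mod 3). Then in row i₀−2 one has C_{i₀−2,j} = 0 for every column j with j ≡ 2 (mod 3); in other words, no lot (i₀−2, j) with C_{i₀,j} = 0 is occupied. -/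
structure ESF (m n : ℕ) (C : ℕ → ℕ → Bool) : Prop where
  f1 : ∀ i j, 1 ≤ i → i ≤ m → 1 ≤ j → j ≤ n → C i j = false →
    1 < j ∧ j < n ∧ i < m ∧ C i (j-1) = true ∧ C i (j+1) = true ∧ C (i+1) j = true
  f2 : ∀ i j, 1 ≤ i → i < m → 1 < j → j < n → C i j = true →
    C i (j-1) = true → C i (j+1) = true → C (i+1) j = true → False
  f3 : ∀ i j, 1 ≤ i → i ≤ m → 1 ≤ j → j ≤ n → C i j = false →
    (1 < i ∧ C (i-1) j = true ∧ C (i-1) (j-1) = true ∧ C (i-1) (j+1) = true) ∨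
    (2 < j ∧ C i (j-2) = true ∧ C (i+1) (j-1) = true) ∨
    (j + 1 < n ∧ C i (j+2) = true ∧ C (i+1) (j+1) = true)

theorem esf_of {m n : ℕ} {C : ℕ → ℕ → Bool} (hmax : IsMaximal2 m n C) (hp : ResistPred2 m n C)
    (ha : ResistAlt2 m n C) : ESF m n C := by
  have f1 : ∀ i j, 1 ≤ i → i ≤ m → 1 ≤ j → j ≤ n → C i j = false →
    1 < j ∧ j < n ∧ i < m ∧ C i (j-1) = true ∧ C i (j+1) = true ∧ C (i+1) j = true := by
    intro i j h1 h2 h3 h4 h5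
    have h := hp i j h1 h2 h3 h4 h5
    have e1 : ¬ (j - 1 = j) := by omega
    simp only [Sun2, occupy2, not_or] at h
    obtain ⟨⟨a1, a2⟩, ⟨a3, a4⟩, a5, a6⟩ := h
    simp [e1] at a2 a4 a6
    refine ⟨by omega, by omega, by omega, a2, a4, a6⟩
  refine ⟨f1, ?_, ?_⟩
  · intro i j h1 h2 h3 h4 h5 h6 h7 h8
    have h := hmax.1 i j h1 (by omega) (by omega) (by omega) h5
    simp only [Sun2, h6, h7, h8] at h
    simp at h
    omega
  · intro i j h1 h2 h3 h4 h5
    obtain ⟨a, b, ha1, ha2, hb1, hb2, hne, hC, hS⟩ := ha i j h1 h2 h3 h4 h5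
    have hs := hmax.1 a b ha1 ha2 hb1 hb2 hC
    have hf := f1 i j h1 h2 h3 h4 h5
    simp only [Sun2, occupy2, not_or] at hS
    obtain ⟨⟨a1, a2⟩, ⟨a3, a4⟩, a5, a6⟩ := hS
    simp only [Sun2, a1, a3, a5, false_or] at hs
    rcases hs with hs | hs | hs
    · have e : a = i ∧ b - 1 = j := by
        by_contra hc
        simp [hc, hs] at a2
      obtain ⟨rfl, rfl⟩ := e
      have e3 : b - 1 + 1 = b := by omega
      have e4 : b - 1 + 2 = b + 1 := by omega
      have e1 : ¬ (b + 1 = b - 1) := by omega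
      have e2 : ¬ (a + 1 = a) := by omega
      simp [e1] at a4 a6
      right; right
      rw [e3, e4]
      exact ⟨by omega, a4, a6⟩
    · have e : a = i ∧ b + 1 = j := by
        by_contra hc
        simp [hc, hs] at a4
      obtain ⟨rfl, rfl⟩ := e
      have e1 : ¬ (b - 1 = b + 1) := by omega
      simp [e1] at a2 a6
      right; left
      exact ⟨by omega, a2, a6⟩
    · have e : a + 1 = i ∧ b = j := by
        by_contra hc
        simp [hc, hs] at a6
      obtain ⟨rfl, rfl⟩ := e
      simp at a2 a4
      left
      exact ⟨by omega, hC, a2, a4⟩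

theorem ESF.mirror {m n : ℕ} {C : ℕ → ℕ → Bool} (F : ESF m n C) :
    ESF m n (fun i j => C i (n + 1 - j)) := by
  refine ⟨?_, ?_, ?_⟩
  · intro i j h1 h2 h3 h4 h5
    have h := F.f1 i (n+1-j) h1 h2 (by omega) (by omega) h5
    have e1 : n + 1 - j - 1 = n + 1 - (j+1) := by omega
    have e2 : n + 1 - j + 1 = n + 1 - (j-1) := by omega
    rw [e1, e2] at h
    refine ⟨by omega, by omega, by omega, h.2.2.2.2.1, h.2.2.2.1, h.2.2.2.2.2⟩
  · intro i j h1 h2 h3 h4 h5 h6 h7 h8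
    have e1 : n + 1 - j - 1 = n + 1 - (j+1) := by omega
    have e2 : n + 1 - j + 1 = n + 1 - (j-1) := by omega
    exact F.f2 i (n+1-j) h1 h2 (by omega) (by omega) h5 (by rw [e1]; exact h7)
      (by rw [e2]; exact h6) h8
  · intro i j h1 h2 h3 h4 h5
    have h0 := F.f1 i (n+1-j) h1 h2 (by omega) (by omega) h5
    have h := F.f3 i (n+1-j) h1 h2 (by omega) (by omega) h5
    have e1 : n + 1 - j - 1 = n + 1 - (j+1) := by omega
    have e2 : n + 1 - j + 1 = n + 1 - (j-1) := by omega
    have e3 : n + 1 - j - 2 = n + 1 - (j+2) := by omega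
    rcases h with h | h | h
    · rw [e1, e2] at h
      exact Or.inl ⟨h.1, h.2.1, h.2.2.2, h.2.2.1⟩
    · rw [e1, e3] at h
      exact Or.inr (Or.inr ⟨by omega, h.2⟩)
    · have e4 : n + 1 - j + 2 = n + 1 - (j-2) := by omega
      rw [e2, e4] at h
      exact Or.inr (Or.inl ⟨by omega, h.2⟩)

/-- the chain, without its end condition -/
def Chain (n : ℕ) (C : ℕ → ℕ → Bool) (i a k : ℕ) : Prop :=
  1 ≤ a ∧ a + 3 + 3 * k ≤ n ∧ C i a = false ∧
    ∀ t, t ≤ k → C i (a + 2 + 3 * t) = false ∧ C (i+1) (a + 1 + 3 * t) = false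

theorem last_right {P : ℕ → Prop} (s : ℕ) (h0 : P 0) (hs : ¬ P s) :
    ∃ r, r < s ∧ P r ∧ ∀ t, r < t → t ≤ s → ¬ P t := by
  induction s with
  | zero => exact absurd h0 hs
  | succ s ih =>
    by_cases h : P s
    · refine ⟨s, by omega, h, ?_⟩
      intro t h1 h2
      obtain rfl : t = s + 1 := by omega
      exact hs
    · obtain ⟨r, h1, h2, h3⟩ := ih h
      refine ⟨r, by omega, h2, ?_⟩
      intro t h4 h5
      by_cases h6 : t = s + 1
      · subst h6; exact hs
      · exact h3 t h4 (by omega)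

theorem first_fail {P : ℕ → Prop} (k : ℕ) (h0 : P 0) (hs : ¬ P k) :
    ∃ s, s < k ∧ (∀ t, t ≤ s → P t) ∧ ¬ P (s+1) := by
  induction k with
  | zero => exact absurd h0 hs
  | succ k ih =>
    by_cases h : P k
    · by_cases h' : ∀ t, t ≤ k → P t
      · exact ⟨k, by omega, h', hs⟩
      · classical
        push Not at h'
        have hm := Nat.find_spec h'
        have hmin := fun t => Nat.find_min h' (m := t)
        generalize Nat.find h' = q at hm hmin
        obtain ⟨q, rfl⟩ : ∃ q', q = q' + 1 := by
          cases q with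
          | zero => exact absurd h0 hm.2
          | succ q => exact ⟨q, rfl⟩
        refine ⟨q, by omega, ?_, hm.2⟩
        intro t ht
        by_contra hc
        exact hmin t (by omega) ⟨by omega, hc⟩
    · obtain ⟨s, h1, h2⟩ := ih h
      exact ⟨s, by omega, h2⟩

theorem no_bad {m n : ℕ} {C : ℕ → ℕ → Bool} (F : ESF m n C) :
    ∀ i, 1 ≤ i → i + 1 ≤ m → ∀ a k, Chain n C i a k →
      (a + 3 + 3 * k = n ∨ C (i+1) (a + 3 + 3 * k) = false) → False := by
  intro i
  induction i using Nat.strong_induction_on with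
  | _ i ih =>
  intro hi him a k hch hend
  obtain ⟨ha, han, hA, hz⟩ := hch
  -- last zero blocks up
  have hl := hz k le_rfl
  have hup : 1 < i ∧ C (i-1) (a+1+3*k) = true := by
    rcases F.f3 i (a+2+3*k) hi (by omega) (by omega) (by omega) hl.1 with h | h | h
    · refine ⟨h.1, ?_⟩
      have e : a + 2 + 3*k - 1 = a+1+3*k := by omega
      rw [e] at h; exact h.2.2.1
    · have e : a + 2 + 3*k - 1 = a+1+3*k := by omega
      rw [e, hl.2] at h; simp at h
    · have e : a + 2 + 3*k + 1 = a+3+3*k := by omega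
      rw [e] at h
      rcases hend with h' | h'
      · omega
      · rw [h'] at h; simp at h
  obtain ⟨hi1, hup⟩ := hup
  obtain ⟨z, rfl⟩ : ∃ z, i = z + 1 := ⟨i-1, by omega⟩
  simp only [Nat.add_sub_cancel] at hup
  have up : ∀ r j, 1 ≤ r → r + 1 ≤ m → 1 ≤ j → j ≤ n → C (r+1) j = false → C r j = true := by
    intro r j h1 h2 h3 h4 h5
    by_contra hc
    have := F.f1 r j h1 (by omega) h3 h4 (by simpa using hc)
    rw [h5] at this; simp at this
  have hZ2 : ∀ t, t ≤ k → C z (a+2+3*t) = true := fun t ht =>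
    up z _ (by omega) (by omega) (by omega) (by omega) (hz t ht).1
  have hZ0 : C z a = true := up z _ (by omega) (by omega) (by omega) (by omega) hA
  have hA1 : C (z+1) (a+1) = true := 
    (F.f1 (z+1) a (by omega) (by omega) (by omega) (by omega) hA).2.2.2.2.1
  have hZ1 : C z (a+1) = false := by
    by_contra hc
    exact F.f2 z (a+1) (by omega) (by omega) (by omega) (by omega) (by simpa using hc)
      hZ0 (hZ2 0 (by omega)) hA1
  obtain ⟨s, hsk, hs, hs'⟩ := first_fail (P := fun t => C z (a+1+3*t) = false) k hZ1 (by simp [hup])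
  have hs'' : C z (a + 4 + 3*s) = true := by
    have e : a + 1 + 3*(s+1) = a+4+3*s := by omega
    rw [e] at hs'; simpa using hs'
  have hA3 : C (z+1) (a+3+3*s) = true := by
    have := (F.f1 (z+1) (a+2+3*s) (by omega) (by omega) (by omega) (by omega)
      (hz s (by omega)).1).2.2.2.2.1
    have e : a + 2+3*s+1 = a+3+3*s := by omega
    rwa [e] at this
  have hZ3 : C z (a+3+3*s) = false := by
    by_contra hc
    have e : a + 3+3*s-1 = a+2+3*s := by omega
    have e' : a + 3+3*s+1 = a+4+3*s := by omega
    exact F.f2 z (a+3+3*s) (by omega) (by omega) (by omega) (by omega) (by simpa using hc)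
      (by rw [e]; exact hZ2 s (by omega)) (by rw [e']; exact hs'') hA3
  -- Z_{a+1} blocks up
  have hY : 1 < z ∧ C (z-1) (a+1) = true ∧ C (z-1) (a+2) = true := by
    rcases F.f3 z (a+1) (by omega) (by omega) (by omega) (by omega) hZ1 with h | h | h
    · exact ⟨h.1, h.2.1, h.2.2.2⟩
    · have := h.2.2
      simp [hA] at this
    · have := h.2.2
      have h2 := (hz 0 (by omega)).1
      simp at h2
      simp [h2] at this
  obtain ⟨hz1, hY1, hY2⟩ := hY
  obtain ⟨y, rfl⟩ : ∃ y, z = y + 1 := ⟨z-1, by omega⟩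
  simp only [Nat.add_sub_cancel] at hY1 hY2
  have hYt : ∀ t, t ≤ s → C y (a+1+3*t) = true := fun t ht =>
    up y _ (by omega) (by omega) (by omega) (by omega) (hs t ht)
  have hpair : ∀ t, t ≤ s → C y (a+2+3*t) = true → C y (a+3+3*t) = false := by
    intro t ht h
    by_contra hc
    have e : a + 2+3*t-1 = a+1+3*t := by omega
    have e' : a + 2+3*t+1 = a+3+3*t := by omega
    exact F.f2 y (a+2+3*t) (by omega) (by omega) (by omega) (by omega) h
      (by rw [e]; exact hYt t ht) (by rw [e']; simpa using hc) (hZ2 t (by omega))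
  have hYs3 : C y (a+3+3*s) = true :=
    up y _ (by omega) (by omega) (by omega) (by omega) hZ3
  obtain ⟨r, hrs, hr, hr'⟩ := last_right (P := fun t => C y (a+2+3*t) = true) s hY2
    (by intro h; have := hpair s le_rfl h; simp [hYs3] at this)
  refine ih y (by omega) (by omega) (by omega) (a+3+3*r) (s-(r+1)) ⟨by omega, by omega, hpair r (by omega) hr, ?_⟩ ?_
  · intro t ht
    have h1 := hr' (t+(r+1)) (by omega) (by omega)
    have h2 := hs (t+(r+1)) (by omega)
    have e : a+3+3*r+2+3*t = a+2+3*(t+(r+1)) := by omega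
    have e' : a+3+3*r+1+3*t = a+1+3*(t+(r+1)) := by omega
    rw [e, e']
    exact ⟨by simpa using h1, h2⟩
  · right
    have e : a+3+3*r+3+3*(s-(r+1)) = a+3+3*s := by omega
    rw [e]; exact hZ3

theorem no_R {m n : ℕ} {C : ℕ → ℕ → Bool} (F : ESF m n C) (hn3 : 3 ∣ n) (i : ℕ) (hi : 1 ≤ i)
    (him : i + 2 ≤ m)
    (hrow : ∀ j, 1 ≤ j → j ≤ n → (C (i+2) j = false ↔ j % 3 = 2)) :
    ∀ d c, n - c = d → 1 ≤ c → c ≤ n → c % 3 = 2 →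
      ((C i c = true ∧ C i (c+1) = false) ∨ (∃ a k, c = a + 2 + 3 * k ∧ Chain n C i a k)) →
      False := by
  intro d
  induction d using Nat.strong_induction_on with
  | _ d ih =>
  intro c hd hc1 hcn hc3 h
  have hcn' : c + 1 ≤ n := by omega
  -- B facts
  have hB2 : ∀ j, 1 ≤ j → j ≤ n → j % 3 = 2 → C (i+1) j = true := by
    intro j h1 h2 h3
    by_contra hc
    have := F.f1 (i+1) j (by omega) (by omega) h1 h2 (by simpa using hc)
    have h4 := (hrow j h1 h2).2 h3
    rw [h4] at this; simp at this
  have hBp : c + 1 < n → C (i+1) (c+1) = true → C (i+1) (c+2) = false := by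
    intro h1 h2
    by_contra hc
    have h3 : C (i+2) (c+1) = true := by
      by_contra hh
      have := (hrow (c+1) (by omega) (by omega)).1 (by simpa using hh)
      omega
    exact F.f2 (i+1) (c+1) (by omega) (by omega) (by omega) (by omega) h2
      (hB2 c hc1 hcn hc3) (by simpa using hc) h3
  have up : ∀ j, 1 ≤ j → j ≤ n → C (i+1) j = false → C i j = true := by
    intro j h3 h4 h5
    by_contra hc
    have := F.f1 i j hi (by omega) h3 h4 (by simpa using hc)
    rw [h5] at this; simp at this
  -- R step
  have hR : c + 1 < n → C (i+1) (c+2) = false → C i (c+3) = true → False := by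
    intro h1 h2 h3
    refine ih (n - (c+3)) (by omega) (c+3) rfl (by omega) (by omega) (by omega) (Or.inl ⟨h3, ?_⟩)
    have h4 := up (c+2) (by omega) (by omega) h2
    have h5 := hB2 (c+3) (by omega) (by omega) (by omega)
    by_contra hc
    exact F.f2 i (c+3) hi (by omega) (by omega) (by omega) h3 h4 (by simpa using hc) h5
  rcases h with ⟨h1, h2⟩ | ⟨a, k, hc, hch⟩
  · have hf := F.f1 i (c+1) hi (by omega) (by omega) hcn' h2
    have hb := hBp hf.2.1 hf.2.2.2.2.2
    by_cases h3 : C i (c+3) = true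
    · exact hR hf.2.1 hb h3
    · refine ih (n - (c+3)) (by omega) (c+3) rfl (by omega) (by omega) (by omega)
        (Or.inr ⟨c+1, 0, by omega, by omega, by omega, h2, ?_⟩)
      intro t ht
      obtain rfl : t = 0 := by omega
      exact ⟨by simpa using h3, hb⟩
  · by_cases hend : (a + 3 + 3 * k = n ∨ C (i+1) (a + 3 + 3 * k) = false)
    · exact no_bad F i hi (by omega) a k hch hend
    · push Not at hend
      have e : a + 3 + 3*k = c+1 := by omega
      rw [e] at hend
      have hb := hBp (by omega) (by simpa using hend.2)
      by_cases h3 : C i (c+3) = true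
      · exact hR (by omega) hb h3
      · obtain ⟨q1, q2, q3, q4⟩ := hch
        refine ih (n - (c+3)) (by omega) (c+3) rfl (by omega) (by omega) (by omega)
          (Or.inr ⟨a, k+1, by omega, by omega, by omega, q3, ?_⟩)
        intro t ht
        by_cases htk : t ≤ k
        · exact q4 t htk
        · obtain rfl : t = k+1 := by omega
          have e1 : a + 2 + 3*(k+1) = c+3 := by omega
          have e2 : a + 1 + 3*(k+1) = c+2 := by omega
          rw [e1, e2]
          exact ⟨by simpa using h3, hb⟩

theorem stmt14 (m n : ℕ) (hn3 : 3 ∣ n) (C : ℕ → ℕ → Bool)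
    (hmax : IsMaximal2 m n C) (hp : ResistPred2 m n C) (ha : ResistAlt2 m n C)
    (i₀ : ℕ) (hi₀ : 3 ≤ i₀) (hi₀m : i₀ ≤ m)
    (hrow : ∀ j, 1 ≤ j → j ≤ n → (C i₀ j = false ↔ j % 3 = 2)) :
    ∀ j, 1 ≤ j → j ≤ n → j % 3 = 2 → C (i₀ - 2) j = false := by
  have F := esf_of hmax hp ha
  obtain ⟨i, rfl⟩ : ∃ i, i₀ = i + 2 := ⟨i₀ - 2, by omega⟩
  intro j h1 h2 h3
  simp only [Nat.add_sub_cancel]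
  by_contra hc
  have hc : C i j = true := by simpa using hc
  have hB : C (i+1) j = true := by
    by_contra hc
    have := F.f1 (i+1) j (by omega) (by omega) h1 h2 (by simpa using hc)
    have h4 := (hrow j h1 h2).2 h3
    rw [h4] at this; simp at this
  by_cases hE : C i (j+1) = false
  · exact no_R F hn3 i (by omega) hi₀m hrow _ j rfl h1 h2 h3 (Or.inl ⟨hc, hE⟩)
  by_cases hW : C i (j-1) = false
  · refine no_R F.mirror hn3 i (by omega) hi₀m ?_ _ (n+1-j) rfl (by omega) (by omega) (by omega)
      (Or.inl ⟨?_, ?_⟩)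
    · intro j' h1' h2'
      have := hrow (n+1-j') (by omega) (by omega)
      simp only [this]
      omega
    · have e : n + 1 - (n+1-j) = j := by omega
      simp only [e]; exact hc
    · have e : n + 1 - (n+1-j+1) = j-1 := by omega
      simp only [e]; exact hW
  exact F.f2 i j (by omega) (by omega) (by omega) (by omega) hc (by simpa using hW)
    (by simpa using hE) hB
end

section
/- Let C be an evolutionary stable configuration on an m×n grid with m > 2 and n > 2. Then n is divisible by 3, the bottom row is fully occupied (C_{m,j} = 1 for all 1 ≤ j ≤ n), and the penultimate row is the periodic pattern 101 101 … 101, i.e., C_{m−1,j} = 0 if and only if j ≡ 2 (mod 3). -/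
/-- Abstract form of an ES configuration: `Z h j` says that the lot at height `h`
above the bottom row and in column `j` is an empty lot of the grid. -/
structure ESGood (m : ℕ) (n : ℤ) (Z : ℕ → ℤ → Prop) : Prop where
  bot : ∀ j, ¬ Z 0 j
  rng : ∀ h j, Z h j → h < m ∧ 2 ≤ j ∧ j ≤ n - 1
  lft : ∀ h j, Z h j → ¬ Z h (j - 1)
  rgt : ∀ h j, Z h j → ¬ Z h (j + 1)
  dwn : ∀ h j, Z (h + 1) j → ¬ Z h j
  per : ∀ h j, h + 1 < m → 2 ≤ j → j ≤ n - 1 →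
    Z (h + 1) j ∨ Z (h + 1) (j - 1) ∨ Z (h + 1) (j + 1) ∨ Z h j
  alt : ∀ h j, Z (h + 1) j →
    (2 ≤ j - 1 ∧ ¬ Z h (j - 1)) ∨ (j + 1 ≤ n - 1 ∧ ¬ Z h (j + 1)) ∨
    (h + 2 < m ∧ ¬ Z (h + 2) (j - 1) ∧ ¬ Z (h + 2) (j + 1))

/-- The lot to the north relies on the empty lot. -/
def ESDef (m : ℕ) (Z : ℕ → ℤ → Prop) (h : ℕ) (j : ℤ) : Prop :=
  Z h j ∧ h + 1 < m ∧ ¬ Z (h + 1) (j - 1) ∧ ¬ Z (h + 1) (j + 1)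

theorem ESGood.mirror {m : ℕ} {n : ℤ} {Z : ℕ → ℤ → Prop} (g : ESGood m n Z) :
    ESGood m n (fun h j => Z h (n + 1 - j)) where
  bot j := g.bot _
  rng h j hz := by
    have := g.rng _ _ hz
    omega
  lft h j hz := by
    have := g.rgt _ _ hz
    rwa [show n + 1 - (j - 1) = n + 1 - j + 1 by ring]
  rgt h j hz := by
    have := g.lft _ _ hz
    rwa [show n + 1 - (j + 1) = n + 1 - j - 1 by ring]
  dwn h j hz := g.dwn _ _ hz
  per h j a b c := by
    have := g.per h (n + 1 - j) a (by omega) (by omega)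
    rw [show n + 1 - (j - 1) = n + 1 - j + 1 by ring,
      show n + 1 - (j + 1) = n + 1 - j - 1 by ring]
    tauto
  alt h j hz := by
    have := g.alt _ _ hz
    rw [show n + 1 - (j - 1) = n + 1 - j + 1 by ring,
      show n + 1 - (j + 1) = n + 1 - j - 1 by ring]
    rcases this with ⟨a, b⟩ | ⟨a, b⟩ | ⟨a, b, c⟩
    · exact Or.inr (Or.inl ⟨by omega, b⟩)
    · exact Or.inl ⟨by omega, b⟩
    · exact Or.inr (Or.inr ⟨a, c, b⟩)

theorem ESDef.mirror {m : ℕ} {Z : ℕ → ℤ → Prop} {h : ℕ} {j : ℤ} (n : ℤ) (k : ℤ)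
    (d : ESDef m Z h j) (hk : k = n + 1 - j) :
    ESDef m (fun h j => Z h (n + 1 - j)) h k := by
  subst hk
  obtain ⟨a, b, c, e⟩ := d
  refine ⟨?_, b, ?_, ?_⟩
  · show Z h (n + 1 - (n + 1 - j))
    rwa [show n + 1 - (n + 1 - j) = j by ring]
  · show ¬ Z (h + 1) (n + 1 - (n + 1 - j - 1))
    rwa [show n + 1 - (n + 1 - j - 1) = j + 1 by ring]
  · show ¬ Z (h + 1) (n + 1 - (n + 1 - j + 1))
    rwa [show n + 1 - (n + 1 - j + 1) = j - 1 by ring]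

theorem ESGood.mk_def {m : ℕ} {n : ℤ} {Z : ℕ → ℤ → Prop} (g : ESGood m n Z) (h : ℕ) (c : ℤ)
    (hm : h + 1 < m) (h2 : 2 ≤ c) (hn : c ≤ n - 1) (hc : ¬ Z h c)
    (hl : c = 2 ∨ Z h (c - 1)) (hr : c + 1 = n ∨ Z h (c + 1)) : ESDef m Z (h + 1) c := by
  have a1 : ¬ Z (h + 1) (c - 1) := by
    intro hz
    rcases hl with hl | hl
    · have := g.rng _ _ hz
      omega
    · exact g.dwn _ _ hz hl
  have a2 : ¬ Z (h + 1) (c + 1) := by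
    intro hz
    rcases hr with hr | hr
    · have := g.rng _ _ hz
      omega
    · exact g.dwn _ _ hz hr
  have z : Z (h + 1) c := by
    have := g.per h c hm h2 hn
    tauto
  refine ⟨z, ?_⟩
  rcases g.alt _ _ z with ⟨p, q⟩ | ⟨p, q⟩ | p
  · rcases hl with hl | hl
    · omega
    · exact absurd hl q
  · rcases hr with hr | hr
    · omega
    · exact absurd hr q
  · exact p

theorem ESGood.conflict {m : ℕ} {n : ℤ} (t : ℕ) : ∀ (Z : ℕ → ℤ → Prop) (_ : ESGood m n Z)
    (h : ℕ) (j : ℤ), ESDef m Z h j → ESDef m Z (h + 1) (j + 3 * t + 1) →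
    (∀ u : ℕ, u ≤ t → Z h (j + 3 * u)) → False := by
  induction t using Nat.strong_induction_on with
  | _ t ih =>
  intro Z g h j d d' hz
  have hj := g.rng _ _ d.1
  have hj' := g.rng _ _ d'.1
  have key : ∀ w : ℕ, w ≤ t → ∀ u : ℕ, u ≤ w → Z (h + 1) (j + 3 * t + 1 - 3 * u) := by
    intro w
    induction w with
    | zero =>
      intro _ u hu
      obtain rfl : u = 0 := by omega
      simpa using d'.1
    | succ w ihw =>
      intro hw u hu
      have ihw := ihw (by omega)
      rcases Nat.lt_or_ge u (w + 1) with hlt | hge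
      · exact ihw u (by omega)
      obtain rfl : u = w + 1 := by omega
      obtain ⟨v, rfl⟩ : ∃ v, t = v + w + 1 := ⟨t - w - 1, by omega⟩
      push_cast at *
      -- v+1 is the current index
      have z0 := hz v (by omega)
      have z1 := hz (v + 1) (by omega)
      have y1 := ihw w le_rfl
      by_contra hno
      rw [show j + 3 * ((v : ℤ) + w + 1) + 1 - 3 * (w + 1) = j + 3 * v + 1 by ring] at hno
      rw [show j + 3 * ((v : ℤ) + w + 1) + 1 - 3 * w = j + 3 * v + 3 + 1 by ring] at y1
      push_cast at z1
      rw [show j + 3 * ((v : ℤ) + 1) = j + 3 * v + 3 by ring] at z1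
      have p := g.per h (j + 3 * v + 1) d.2.1 (by omega) (by omega)
      have q1 : ¬ Z (h + 1) (j + 3 * v + 1 - 1) := by
        rw [show j + 3 * (v : ℤ) + 1 - 1 = j + 3 * v by ring]
        exact fun hh => g.dwn _ _ hh z0
      have q2 := g.rgt _ _ z0
      have y0 : Z (h + 1) (j + 3 * v + 1 + 1) := by tauto
      have dd := g.mk_def (h + 1) (j + 3 * v + 3) d'.2.1 (by omega) (by omega)
        (fun hh => g.dwn _ _ hh z1)
        (Or.inr (by rwa [show j + 3 * (v : ℤ) + 3 - 1 = j + 3 * v + 1 + 1 by ring])) (Or.inr y1)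
      refine ih w (by omega) _ g.mirror (h + 1) (n + 1 - (j + 3 * ((v : ℤ) + w + 1) + 1))
        (d'.mirror n _ rfl) (dd.mirror n _ (by ring)) ?_
      intro u hu
      have := ihw u hu
      show Z (h + 1) _
      rwa [show n + 1 - (n + 1 - (j + 3 * ((v : ℤ) + w + 1) + 1) + 3 * u)
        = j + 3 * ((v : ℤ) + w + 1) + 1 - 3 * u by ring]
  have := key t le_rfl t le_rfl
  rw [show j + 3 * (t : ℤ) + 1 - 3 * t = j + 1 by ring] at this
  exact d.2.2.2 this

theorem ESGood.no_def {m : ℕ} {n : ℤ} {Z : ℕ → ℤ → Prop} (g : ESGood m n Z) (j : ℤ)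
    (d : ESDef m Z 2 j) (h1 : Z 1 (j + 1)) : False := by
  have key : ∀ k : ℕ, (∀ u : ℕ, u ≤ k → Z 2 (j + 3 * u)) ∧ Z 1 (j + 3 * k + 1) := by
    intro k
    induction k with
    | zero =>
      refine ⟨?_, by simpa using h1⟩
      intro u hu
      obtain rfl : u = 0 := by omega
      simpa using d.1
    | succ k ih =>
      obtain ⟨ha, hb⟩ := ih
      have hk := ha k le_rfl
      obtain ⟨c, hc⟩ : ∃ c, c = j + 3 * (k : ℤ) + 1 := ⟨_, rfl⟩
      rw [← hc] at hb
      rw [show j + 3 * (k : ℤ) = c - 1 by omega] at hk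
      have r := g.rng _ _ hb
      have n2 : ¬ Z 2 c := fun hh => g.dwn _ _ hh hb
      have nn : ¬ (c + 1 = n ∨ Z 2 (c + 1)) := by
        intro hh
        have dd := g.mk_def 2 c d.2.1 (by omega) (by omega) n2 (Or.inr hk) hh
        rw [hc] at dd
        exact g.conflict k Z 2 j d dd ha
      rw [not_or] at nn
      have p := g.per 1 (c + 1) (by have := d.2.1; omega) (by omega) (by omega)
      have e := g.rgt _ _ hb
      rw [show c + 1 - 1 = c by ring, show c + 1 + 1 = c + 2 by ring] at p
      have z2 : Z 2 (c + 2) := by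
        have := nn.2
        tauto
      have r2 := g.rng _ _ z2
      have p1 := g.per 0 (c + 2) (by have := d.2.1; omega) (by omega) (by omega)
      have e1 := g.dwn _ _ z2
      have e2 := g.bot (c + 2)
      rw [show c + 2 - 1 = c + 1 by ring, show c + 2 + 1 = c + 3 by ring] at p1
      have z1 : Z 1 (c + 3) := by
        simp only [zero_add] at p1 e1
        tauto
      refine ⟨?_, ?_⟩
      · intro u hu
        rcases Nat.lt_or_ge u (k + 1) with hlt | hge
        · exact ha u (by omega)
        obtain rfl : u = k + 1 := by omega
        push_cast
        rwa [show j + 3 * ((k : ℤ) + 1) = c + 2 by omega]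
      · push_cast
        rwa [show j + 3 * ((k : ℤ) + 1) + 1 = c + 3 by omega]
  have a := key n.toNat
  have := g.rng _ _ a.2
  have := g.rng _ _ d.1
  omega

theorem ESGood.nodef {m : ℕ} {n : ℤ} {Z : ℕ → ℤ → Prop} (g : ESGood m n Z) (hm : 2 < m) (j : ℤ)
    (hl : j = 2 ∨ Z 1 (j - 1)) (hr : Z 1 (j + 1)) : False := by
  have r := g.rng _ _ hr
  have hj : 2 ≤ j := by
    rcases hl with hl | hl
    · omega
    · have := g.rng _ _ hl
      omega
  have hz : ¬ Z 1 j := fun hh => g.rgt _ _ hh hr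
  exact g.no_def j (g.mk_def 1 j hm hj (by omega) hz hl (Or.inr hr)) hr

theorem ESGood.main {m : ℕ} {n : ℤ} {Z : ℕ → ℤ → Prop} (g : ESGood m n Z) (hm : 2 < m)
    (hn : 2 < n) (k : ℕ) : 3 * (k : ℤ) + 1 ≤ n → 3 * (k : ℤ) + 3 ≤ n ∧ Z 1 (3 * k + 2) := by
  induction k with
  | zero =>
    intro _
    refine ⟨by push_cast; omega, ?_⟩
    by_contra hno
    simp only [Nat.cast_zero, mul_zero, zero_add] at hno
    have p := g.per 0 2 (by omega) (by omega) (by omega)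
    have q : ¬ Z 1 (2 - 1) := fun hh => by
      have := g.rng _ _ hh
      omega
    have b := g.bot 2
    simp only [zero_add] at p
    exact g.nodef hm 2 (Or.inl rfl) (by tauto)
  | succ k ih =>
    intro hk
    push_cast at hk ⊢
    obtain ⟨_, z⟩ := ih (by omega)
    obtain ⟨c, hc⟩ : ∃ c, c = 3 * (k : ℤ) + 2 := ⟨_, rfl⟩
    rw [← hc] at z
    have r := g.rng _ _ z
    have n2 : ¬ Z 1 (c + 2) := by
      intro hh
      exact g.nodef hm (c + 1) (Or.inr (by rwa [show c + 1 - 1 = c by ring]))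
        (by rwa [show c + 1 + 1 = c + 2 by ring])
    have n3 : c + 2 ≠ n := by
      intro hh
      refine g.mirror.nodef hm 2 (Or.inl rfl) ?_
      show Z 1 _
      rwa [show n + 1 - (2 + 1) = c by omega]
    have p := g.per 0 (c + 2) (by omega) (by omega) (by omega)
    have e := g.rgt _ _ z
    have b := g.bot (c + 2)
    rw [show c + 2 - 1 = c + 1 by ring, show c + 2 + 1 = c + 3 by ring] at p
    simp only [zero_add] at p
    have z3 : Z 1 (c + 3) := by tauto
    have r3 := g.rng _ _ z3
    refine ⟨by omega, ?_⟩
    rwa [show 3 * ((k : ℤ) + 1) + 2 = c + 3 by omega]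

/-- Empty lot of the grid, by height and column. -/
def ESZero (m n : ℕ) (C : ℕ → ℕ → Bool) (h : ℕ) (j : ℤ) : Prop :=
  h < m ∧ 1 ≤ j ∧ j ≤ n ∧ C (m - h) j.toNat = false

theorem ES_pred {m n : ℕ} {C : ℕ → ℕ → Bool} (hp : ResistPred2 m n C) (i j : ℕ)
    (h1 : 1 ≤ i) (h2 : i ≤ m) (h3 : 1 ≤ j) (h4 : j ≤ n) (hC : C i j = false) :
    2 ≤ j ∧ j + 1 ≤ n ∧ i + 1 ≤ m ∧ C i (j - 1) = true ∧ C i (j + 1) = true ∧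
      C (i + 1) j = true := by
  have := hp i j h1 h2 h3 h4 hC
  simp only [Sun2, occupy2, not_or] at this
  obtain ⟨⟨a, b⟩, ⟨c, d⟩, e, f⟩ := this
  have b' : C i (j - 1) = true := by
    rw [if_neg (by omega)] at b
    simpa using b
  have d' : C i (j + 1) = true := by
    rw [if_neg (by omega)] at d
    simpa using d
  have f' : C (i + 1) j = true := by
    rw [if_neg (by omega)] at f
    simpa using f
  exact ⟨by omega, by omega, by omega, b', d', f'⟩

theorem ES_alt {m n : ℕ} {C : ℕ → ℕ → Bool} (hmax : Permissible2 m n C)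
    (ha : ResistAlt2 m n C) (i j : ℕ)
    (h1 : 1 ≤ i) (h2 : i ≤ m) (h3 : 1 ≤ j) (h4 : j ≤ n) (hC : C i j = false) :
    (3 ≤ j ∧ C (i + 1) (j - 1) = true) ∨ (j + 2 ≤ n ∧ C (i + 1) (j + 1) = true) ∨
    (2 ≤ i ∧ C (i - 1) (j - 1) = true ∧ C (i - 1) (j + 1) = true) := by
  obtain ⟨a, b, a1, a2, b1, b2, hne, hab, hs⟩ := ha i j h1 h2 h3 h4 hC
  have hp := hmax a b a1 a2 b1 b2 hab
  simp only [Sun2, occupy2, not_or] at hs hp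
  obtain ⟨⟨s1, s2⟩, ⟨s3, s4⟩, s5, s6⟩ := hs
  rcases hp with (hp | hp) | (hp | hp) | (hp | hp)
  · exact absurd hp s1
  · -- west of (a,b) is empty, so it is (i,j)
    by_cases hh : a = i ∧ b - 1 = j
    · obtain ⟨rfl, hb⟩ := hh
      obtain rfl : b = j + 1 := by omega
      rw [if_neg (by omega)] at s6
      exact Or.inr (Or.inl ⟨by omega, by simpa using s6⟩)
    · rw [if_neg hh] at s2
      exact absurd hp s2
  · exact absurd hp s3
  · by_cases hh : a = i ∧ b + 1 = j
    · obtain ⟨rfl, hb⟩ := hh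
      obtain rfl : b = j - 1 := by omega
      rw [if_neg (by omega)] at s6
      exact Or.inl ⟨by omega, by simpa using s6⟩
    · rw [if_neg hh] at s4
      exact absurd hp s4
  · exact absurd hp s5
  · by_cases hh : a + 1 = i ∧ b = j
    · obtain ⟨hb, rfl⟩ := hh
      obtain rfl : a = i - 1 := by omega
      rw [if_neg (by omega)] at s2 s4
      exact Or.inr (Or.inr ⟨by omega, by simpa using s2, by simpa using s4⟩)
    · rw [if_neg hh] at s6
      exact absurd hp s6

theorem ES_good {m n : ℕ} {C : ℕ → ℕ → Bool}
    (hmax : IsMaximal2 m n C) (hp : ResistPred2 m n C) (ha : ResistAlt2 m n C) :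
    ESGood m n (ESZero m n C) := by
  have pred : ∀ h j, ESZero m n C h j → 2 ≤ j ∧ j + 1 ≤ n ∧ 1 ≤ h ∧
      C (m - h) (j - 1).toNat = true ∧ C (m - h) (j + 1).toNat = true ∧
      C (m - h + 1) j.toNat = true := by
    rintro h j ⟨a, b, c, d⟩
    obtain ⟨q1, q2, q3, q4, q5, q6⟩ :=
      ES_pred hp (m - h) j.toNat (by omega) (by omega) (by omega) (by omega) d
    rw [show j.toNat - 1 = (j - 1).toNat by omega] at q4
    rw [show j.toNat + 1 = (j + 1).toNat by omega] at q5
    exact ⟨by omega, by omega, by omega, q4, q5, q6⟩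
  refine ⟨?_, ?_, ?_, ?_, ?_, ?_, ?_⟩
  · intro j hz
    have := pred _ _ hz
    omega
  · intro h j hz
    have := pred _ _ hz
    have := hz.1
    omega
  · intro h j hz hz'
    have q := (pred _ _ hz).2.2.2.1
    rw [hz'.2.2.2] at q
    simp at q
  · intro h j hz hz'
    have q := (pred _ _ hz).2.2.2.2.1
    rw [hz'.2.2.2] at q
    simp at q
  · intro h j hz hz'
    have q := (pred _ _ hz).2.2.2.2.2
    rw [show m - (h + 1) + 1 = m - h by have := hz.1; omega, hz'.2.2.2] at q
    simp at q
  · intro h j hm h2 hn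
    by_cases hC : C (m - (h + 1)) j.toNat = false
    · exact Or.inl ⟨by omega, by omega, by omega, hC⟩
    right
    have s := hmax.1 (m - (h + 1)) j.toNat (by omega) (by omega) (by omega) (by omega)
      (by simpa using hC)
    rcases s with (s | s) | (s | s) | (s | s)
    · omega
    · rw [show j.toNat - 1 = (j - 1).toNat by omega] at s
      exact Or.inl ⟨by omega, by omega, by omega, s⟩
    · omega
    · rw [show j.toNat + 1 = (j + 1).toNat by omega] at s
      exact Or.inr (Or.inl ⟨by omega, by omega, by omega, s⟩)
    · omega
    · rw [show m - (h + 1) + 1 = m - h by omega] at s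
      exact Or.inr (Or.inr ⟨by omega, by omega, by omega, s⟩)
  · rintro h j ⟨a, b, c, d⟩
    have s := ES_alt hmax.1 ha (m - (h + 1)) j.toNat (by omega) (by omega) (by omega)
      (by omega) d
    rw [show j.toNat - 1 = (j - 1).toNat by omega, show j.toNat + 1 = (j + 1).toNat by omega,
      show m - (h + 1) + 1 = m - h by omega, show m - (h + 1) - 1 = m - (h + 2) by omega] at s
    rcases s with ⟨s1, s2⟩ | ⟨s1, s2⟩ | ⟨s1, s2, s3⟩
    · refine Or.inl ⟨by omega, fun hz => ?_⟩
      exact absurd (hz.2.2.2.symm.trans s2) (by decide)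
    · refine Or.inr (Or.inl ⟨by omega, fun hz => ?_⟩)
      exact absurd (hz.2.2.2.symm.trans s2) (by decide)
    · refine Or.inr (Or.inr ⟨by omega, fun hz => ?_, fun hz => ?_⟩)
      · exact absurd (hz.2.2.2.symm.trans s2) (by decide)
      · exact absurd (hz.2.2.2.symm.trans s3) (by decide)

/-- in an `m × n` ES configuration with `m, n > 2`, `3 ∣ n`, the bottom
row is fully occupied, and the penultimate row is the pattern `101 101 … 101`. -/
theorem stmt17 (m n : ℕ) (hm : 2 < m) (hn : 2 < n) (C : ℕ → ℕ → Bool)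
    (hmax : IsMaximal2 m n C) (hp : ResistPred2 m n C) (ha : ResistAlt2 m n C) :
    3 ∣ n ∧ (∀ j, 1 ≤ j → j ≤ n → C m j = true) ∧
      (∀ j, 1 ≤ j → j ≤ n → (C (m - 1) j = false ↔ j % 3 = 2)) := by
  have g := ES_good hmax hp ha
  have M := g.main hm (by exact_mod_cast hn)
  have h3 : n % 3 = 0 := by
    by_contra hne
    have := (M (n / 3) (by omega)).1
    omega
  refine ⟨by omega, ?_, ?_⟩
  · intro j h1 h2
    by_contra hC
    exact g.bot j ⟨by omega, by omega, by omega, by simpa using hC⟩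
  · intro j h1 h2
    have hz : C (m - 1) j = false ↔ ESZero m n C 1 j := by
      constructor
      · intro h
        exact ⟨by omega, by omega, by omega, by simpa using h⟩
      · intro h
        simpa using h.2.2.2
    rw [hz]
    have z := (M ((j - 1) / 3) (by omega)).2
    constructor
    · intro h
      by_contra hne
      rcases (by omega : j % 3 = 0 ∨ j % 3 = 1) with h0 | h0
      · refine g.lft _ _ h ?_
        rwa [show (j : ℤ) - 1 = 3 * ((j - 1) / 3 : ℕ) + 2 by omega]
      · refine g.rgt _ _ h ?_
        rwa [show (j : ℤ) + 1 = 3 * ((j - 1) / 3 : ℕ) + 2 by omega]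
    · intro h
      rwa [show (j : ℤ) = 3 * ((j - 1) / 3 : ℕ) + 2 by omega]
end

section
/- Let C be an evolutionary stable configuration on an m×n grid with m > 2 and n > 2. Then n is divisible by 3, and for every integer k ≥ 0 with m−1−2k ≥ 1, row m−1−2k equals the periodic pattern 101 101 … 101, i.e., C_{m−1−2k,j} = 0 if and only if j ≡ 2 (mod 3); in particular all these rows are identical to the penultimate row. -/
structure HH (m n : ℕ) (C : ℕ → ℕ → Bool) : Prop where
  z : ∀ i j, 1 ≤ i → i ≤ m → 1 ≤ j → j ≤ n → C i j = false →
    1 < j ∧ j < n ∧ i < m ∧ C i (j-1) = true ∧ C i (j+1) = true ∧ C (i+1) j = true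
  p : ∀ i j, 1 ≤ i → i < m → 1 < j → j < n → C i j = true →
    C i (j-1) = false ∨ C i (j+1) = false ∨ C (i+1) j = false
  a : ∀ i j, 1 ≤ i → i ≤ m → 1 ≤ j → j ≤ n → C i j = false →
    (3 ≤ j ∧ C i (j-2) = true ∧ C (i+1) (j-1) = true) ∨
    (j + 2 ≤ n ∧ C i (j+2) = true ∧ C (i+1) (j+1) = true) ∨
    (2 ≤ i ∧ C (i-1) (j-1) = true ∧ C (i-1) j = true ∧ C (i-1) (j+1) = true)

theorem HH.of (m n : ℕ) (C : ℕ → ℕ → Bool)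
    (hmax : IsMaximal2 m n C) (hp : ResistPred2 m n C) (ha : ResistAlt2 m n C) : HH m n C := by
  have hperm := hmax.1
  have z : ∀ i j, 1 ≤ i → i ≤ m → 1 ≤ j → j ≤ n → C i j = false →
    1 < j ∧ j < n ∧ i < m ∧ C i (j-1) = true ∧ C i (j+1) = true ∧ C (i+1) j = true := by
    intro i j h1 h2 h3 h4 h5
    have := hp i j h1 h2 h3 h4 h5
    unfold Sun2 occupy2 at this
    push Not at this
    obtain ⟨⟨a1, a2⟩, ⟨a3, a4⟩, a5, a6⟩ := this
    have e1 : j - 1 ≠ j := by omega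
    simp [e1] at a2 a4 a6
    refine ⟨by omega, by omega, by omega, a2, a4, a6⟩
  refine ⟨z, ?_, ?_⟩
  · intro i j h1 h2 h3 h4 h5
    have := hperm i j h1 (by omega) (by omega) (by omega) h5
    unfold Sun2 at this
    rcases this with (h | h) | (h | h) | (h | h) <;> first | omega | simp [h]
  · intro i j h1 h2 h3 h4 h5
    obtain ⟨a, b, g1, g2, g3, g4, g5, g6, g7⟩ := ha i j h1 h2 h3 h4 h5
    have hs := hperm a b g1 g2 g3 g4 g6
    unfold Sun2 occupy2 at g7
    push Not at g7
    obtain ⟨⟨a1, a2⟩, ⟨a3, a4⟩, a5, a6⟩ := g7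
    unfold Sun2 at hs
    have hz := z i j h1 h2 h3 h4 h5
    rcases hs with (h | h) | (h | h) | (h | h)
    · omega
    · have : a = i ∧ b - 1 = j := by
        by_contra hc
        simp [hc, h] at a2
      obtain ⟨rfl, rfl⟩ := this
      right; left
      have e : b - 1 + 2 = b + 1 := by omega
      have e' : b - 1 + 1 = b := by omega
      rw [e, e']
      refine ⟨by omega, ?_, ?_⟩
      · have : b + 1 ≠ b - 1 := by omega
        simpa [this] using a4
      · simpa using a6
    · omega
    · have : a = i ∧ b + 1 = j := by
        by_contra hc
        simp [hc, h] at a4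
      obtain ⟨rfl, rfl⟩ := this
      left
      have e : b + 1 - 2 = b - 1 := by omega
      have e' : b + 1 - 1 = b := by omega
      rw [e, e']
      refine ⟨by omega, ?_, ?_⟩
      · have : b - 1 ≠ b + 1 := by omega
        simpa [this] using a2
      · simpa using a6
    · omega
    · have : a + 1 = i ∧ b = j := by
        by_contra hc
        simp [hc, h] at a6
      obtain ⟨rfl, rfl⟩ := this
      right; right
      simp at a2 a4
      exact ⟨by omega, by simpa using a2, by simpa using g6, by simpa using a4⟩

theorem HH.mir {m n : ℕ} {C : ℕ → ℕ → Bool} (H : HH m n C) :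
    HH m n (fun i j => C i (n + 1 - j)) := by
  refine ⟨?_, ?_, ?_⟩
  · intro i j h1 h2 h3 h4 h5
    have := H.z i (n+1-j) h1 h2 (by omega) (by omega) h5
    have e1 : n + 1 - j - 1 = n + 1 - (j + 1) := by omega
    have e2 : n + 1 - j + 1 = n + 1 - (j - 1) := by omega
    rw [e1, e2] at this
    obtain ⟨a, b, c, d, e, f⟩ := this
    exact ⟨by omega, by omega, c, e, d, f⟩
  · intro i j h1 h2 h3 h4 h5
    have := H.p i (n+1-j) h1 h2 (by omega) (by omega) h5
    have e1 : n + 1 - j - 1 = n + 1 - (j + 1) := by omega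
    have e2 : n + 1 - j + 1 = n + 1 - (j - 1) := by omega
    rw [e1, e2] at this
    tauto
  · intro i j h1 h2 h3 h4 h5
    have := H.a i (n+1-j) h1 h2 (by omega) (by omega) h5
    have hz := H.z i (n+1-j) h1 h2 (by omega) (by omega) h5
    have e1 : n + 1 - j - 1 = n + 1 - (j + 1) := by omega
    have e2 : n + 1 - j + 1 = n + 1 - (j - 1) := by omega
    have e3 : n + 1 - j - 2 = n + 1 - (j + 2) := by omega
    rw [e1, e2, e3] at this
    rcases this with h | h | h
    · right; left
      exact ⟨by omega, h.2⟩
    · left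
      have e4 : n + 1 - j + 2 = n + 1 - (j - 2) := by omega
      rw [e4] at h
      exact ⟨by omega, h.2⟩
    · right; right
      exact ⟨h.1, h.2.2.2, h.2.2.1, h.2.1⟩

/-- defect at `a` in row `r` -/
def DD (n : ℕ) (C : ℕ → ℕ → Bool) (r a : ℕ) : Prop :=
  2 ≤ a ∧ a + 1 ≤ n ∧ C r a = true ∧ (a = 2 ∨ C r (a-1) = false) ∧ (a + 1 = n ∨ C r (a+1) = false)

section
variable {m n : ℕ} {C : ℕ → ℕ → Bool}

theorem HH.edge1 (H : HH m n C) {i : ℕ} (h1 : 1 ≤ i) (h2 : i ≤ m) (hn : 2 < n) : C i 1 = true := by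
  by_contra h
  have := H.z i 1 h1 h2 le_rfl (by omega) (by simpa using h)
  omega

theorem HH.edgen (H : HH m n C) {i : ℕ} (h1 : 1 ≤ i) (h2 : i ≤ m) (hn : 2 < n) : C i n = true := by
  by_contra h
  have := H.z i n h1 h2 (by omega) (by omega) (by simpa using h)
  omega

theorem HH.up (H : HH m n C) {i j : ℕ} (h1 : 1 ≤ i) (h2 : i + 1 ≤ m) (h3 : 1 ≤ j) (h4 : j ≤ n)
    (h : C (i+1) j = false) : C i j = true := by
  by_contra h'
  have := H.z i j h1 (by omega) h3 h4 (by simpa using h')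
  simp [h] at this

theorem HH.F (H : HH m n C) (hn : 2 < n) {r a : ℕ} (h1 : 1 ≤ r) (h2 : r + 1 ≤ m)
    (hD : DD n C (r+1) a) : C r a = false ∧ 2 ≤ r ∧ C (r-1) (a-1) = true ∧ C (r-1) a = true ∧
      C (r-1) (a+1) = true ∧ (a = 2 ∨ 3 < a ∧ C (r-1) (a-2) = false) ∧
      (a + 1 = n ∨ a + 2 < n ∧ C (r-1) (a+2) = false) := by
  obtain ⟨a2, an, ha, hl, hr⟩ := hD
  have L : C r (a-1) = true := by
    rcases hl with rfl | hl
    · exact H.edge1 h1 (by omega) hn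
    · exact H.up h1 h2 (by omega) (by omega) hl
  have R : C r (a+1) = true := by
    rcases hr with rfl | hr
    · exact H.edgen h1 (by omega) hn
    · exact H.up h1 h2 (by omega) (by omega) hr
  have h0 : C r a = false := by
    by_contra hc
    have := H.p r a h1 (by omega) (by omega) (by omega) (by simpa using hc)
    simp [L, R, ha] at this
  have hN : 2 ≤ r ∧ C (r-1) (a-1) = true ∧ C (r-1) a = true ∧ C (r-1) (a+1) = true := by
    rcases H.a r a h1 (by omega) (by omega) (by omega) h0 with h | h | h
    · rcases hl with rfl | hl
      · omega
      · simp [hl] at h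
    · rcases hr with rfl | hr
      · omega
      · simp [hr] at h
    · exact h
  obtain ⟨g1, g2, g3, g4⟩ := hN
  refine ⟨h0, g1, g2, g3, g4, ?_, ?_⟩
  · rcases Nat.lt_or_ge 2 a with h | h
    · right
      have := H.p (r-1) (a-1) (by omega) (by omega) (by omega) (by omega) g2
      have e1 : a - 1 - 1 = a - 2 := by omega
      have e2 : a - 1 + 1 = a := by omega
      have e3 : r - 1 + 1 = r := by omega
      rw [e1, e2, e3] at this
      simp [g3, L] at this
      have := H.z (r-1) (a-2) (by omega) (by omega) (by omega) (by omega) this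
      refine ⟨by omega, by assumption⟩
    · left; omega
  · rcases Nat.lt_or_ge (a+1) n with h | h
    · right
      have := H.p (r-1) (a+1) (by omega) (by omega) (by omega) (by omega) g4
      have e1 : a + 1 - 1 = a := by omega
      have e3 : r - 1 + 1 = r := by omega
      rw [e1, e3] at this
      simp [g3, R] at this
      have := H.z (r-1) (a+2) (by omega) (by omega) (by omega) (by omega) this
      refine ⟨by omega, by assumption⟩
    · left; omega

theorem HH.D2 (H : HH m n C) {r p : ℕ} (h1 : 1 ≤ r) (h2 : r ≤ m)
    (hp : 1 ≤ p) (hpn : p + 2 ≤ n) (z1 : C r p = false) (z2 : C r (p+2) = false) : DD n C r (p+1) := by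
  have := H.z r p h1 h2 hp (by omega) z1
  exact ⟨by omega, by omega, this.2.2.2.2.1, Or.inr (by simpa using z1), Or.inr z2⟩

/-- one new zero in each gap -/
theorem HH.G (H : HH m n C) (hn : 2 < n) {r p q : ℕ} (h1 : 1 ≤ r) (h2 : r + 1 ≤ m)
    (hp : 1 ≤ p) (hqn : q ≤ n) (hpq : p + 2 ≤ q) (hpq' : q ≤ p + 4)
    (z1 : C (r+1) p = false) (z2 : C (r+1) q = false) :
    ∃ u, C r u = false ∧ p + 1 ≤ u ∧ u ≤ p + 2 ∧ q ≤ u + 2 ∧ u + 1 ≤ q := by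
  have P1 := H.z (r+1) p (by omega) h2 hp (by omega) z1
  have Q1 := H.z (r+1) q (by omega) h2 (by omega) (by omega) z2
  have Up := H.up h1 h2 hp (by omega) z1
  have Uq := H.up h1 h2 (by omega) hqn z2
  have : q = p + 2 ∨ q = p + 3 ∨ q = p + 4 := by omega
  rcases this with rfl | rfl | rfl
  · have := H.F hn h1 h2 (H.D2 (by omega) h2 hp hqn z1 z2)
    exact ⟨p+1, this.1, by omega⟩
  · by_contra hc
    push Not at hc
    have A : C r (p+1) = true := by
      by_contra h
      have := hc (p+1) (by simpa using h)
      omega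
    have B : C r (p+2) = true := by
      by_contra h
      have := hc (p+2) (by simpa using h)
      omega
    have := H.p r (p+1) h1 (by omega) (by omega) (by omega) A
    simp [Up, B, P1] at this
  · refine ⟨p+2, ?_, by omega⟩
    have M : C (r+1) (p+2) = true := by
      by_contra h
      have h : C (r+1) (p+2) = false := by simpa using h
      have a1 := H.F hn h1 h2 (H.D2 (by omega) h2 hp (by omega) z1 h)
      have a2 := H.F hn h1 h2 (H.D2 (by omega) h2 (by omega) (by omega) h z2)
      have e : p + 2 + 1 = p + 1 + 2 := by omega
      rw [e] at a2
      rcases a1.2.2.2.2.2.2 with h | h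
      · omega
      · simp [a2] at h
    by_contra hc
    have B : C r (p+2) = true := by simpa using hc
    have e3 : p + 4 - 1 = p + 3 := by omega
    rw [e3] at Q1
    have A : C r (p+1) = false := by
      by_contra h
      have := H.p r (p+1) h1 (by omega) (by omega) (by omega) (by simpa using h)
      simp [Up, B, P1] at this
    have D : C r (p+3) = false := by
      by_contra h
      have := H.p r (p+3) h1 (by omega) (by omega) (by omega) (by simpa using h)
      simp [Uq, B, Q1] at this
    have a1 := H.a r (p+1) h1 (by omega) (by omega) (by omega) A
    have a2 := H.a r (p+3) h1 (by omega) (by omega) (by omega) D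
    have e4 : p + 3 - 2 = p + 1 := by omega
    simp [z1, D] at a1
    simp [z2, A, e4] at a2
    have := H.p (r-1) (p+2) (by omega) (by omega) (by omega) (by omega) a1.2.2.2
    have e3 : r - 1 + 1 = r := by omega
    simp [a1, a2, B, e3] at this

theorem HH.E (H : HH m n C) (hn : 2 < n) {r p : ℕ} (h1 : 1 ≤ r) (h2 : r + 1 ≤ m)
    (hp : p = 3 ∨ p = 4) (hpn : p ≤ n) (z1 : C (r+1) p = false) :
    ∃ u, C r u = false ∧ 2 ≤ u ∧ u ≤ 3 ∧ p ≤ u + 2 ∧ u + 1 ≤ p := by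
  have P1 := H.z (r+1) p (by omega) h2 (by omega) (by omega) z1
  have Up := H.up h1 h2 (by omega) (by omega) z1
  have U1 := H.edge1 h1 (by omega) hn
  rcases hp with rfl | rfl
  · have := H.F hn h1 h2 (a := 2) ⟨by omega, by omega, P1.2.2.2.1, Or.inl rfl, Or.inr z1⟩
    exact ⟨2, this.1, by omega⟩
  · have M : C (r+1) 2 = true := by
      by_contra h
      have h : C (r+1) 2 = false := by simpa using h
      have a1 := H.F hn h1 h2 (H.D2 (by omega) h2 (by omega) (by omega) h z1)
      omega
    by_contra hc
    push Not at hc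
    have A : C r 2 = true := by
      by_contra h
      have := hc 2 (by simpa using h)
      omega
    have B : C r 3 = true := by
      by_contra h
      have := hc 3 (by simpa using h)
      omega
    have := H.p r 2 h1 (by omega) (by omega) (by omega) A
    simp [U1, B, M] at this
end

def WW (n : ℕ) (C : ℕ → ℕ → Bool) (r t : ℕ) (z : ℕ → ℕ) : Prop :=
  (∀ s ≤ t, 1 ≤ z s ∧ z s ≤ n ∧ C r (z s) = false) ∧ ∀ s < t, z s + 2 ≤ z (s+1) ∧ z (s+1) ≤ z s + 4

def KP (n : ℕ) (C : ℕ → ℕ → Bool) (r : ℕ) : Prop :=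
  ∀ t z, WW n C r t z → z 0 + 3 * t < z t + 2

def BP (n : ℕ) (C : ℕ → ℕ → Bool) (r : ℕ) : Prop :=
  ∀ t z, WW n C r t z → z 0 = 2 → z 0 + 3 * t ≤ z t

section
variable {m n : ℕ} {C : ℕ → ℕ → Bool}

theorem WW.suffix {r t : ℕ} {z : ℕ → ℕ} (h : WW n C r t z) (i : ℕ) (hi : i ≤ t) :
    WW n C r (t - i) (fun s => z (i + s)) :=
  ⟨fun s hs => h.1 (i+s) (by omega), fun s hs => h.2 (i+s) (by omega)⟩

theorem WW.pre {r t : ℕ} {z : ℕ → ℕ} (h : WW n C r t z) (i : ℕ) (hi : i ≤ t) :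
    WW n C r i z :=
  ⟨fun s hs => h.1 s (by omega), fun s hs => h.2 s (by omega)⟩

theorem WW.gap2 {r t : ℕ} {z : ℕ → ℕ} (h : WW n C r t z) (hd : z t < z 0 + 3 * t) :
    ∃ s < t, z (s+1) = z s + 2 := by
  by_contra hc
  push Not at hc
  have : ∀ s ≤ t, z 0 + 3 * s ≤ z s := by
    intro s
    induction s with
    | zero => simp
    | succ s ih =>
      intro hs
      have := ih (by omega)
      have := hc s (by omega)
      have := h.2 s (by omega)
      omega
  have := this t le_rfl
  omega

theorem WW.first {r t : ℕ} {z : ℕ → ℕ} (h : WW n C r t z) (hd : z t < z 0 + 3 * t) :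
    (∃ i ≤ t, z 0 + 3 * i < z i) ∨
    (∃ k < t, (∀ s ≤ k, z s = z 0 + 3 * s) ∧ z (k+1) = z k + 2) := by
  by_contra hc
  push Not at hc
  have : ∀ k ≤ t, ∀ s ≤ k, z s = z 0 + 3 * s := by
    intro k
    induction k with
    | zero => intro _ s hs; obtain rfl : s = 0 := by omega
              simp
    | succ k ih =>
      intro hk s hs
      have i1 := ih (by omega)
      rcases Nat.lt_or_ge k s with h' | h'
      · obtain rfl : s = k + 1 := by omega
        have := hc.2 k (by omega) i1
        have := hc.1 (k+1) (by omega)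
        have := h.2 k (by omega)
        have := i1 k le_rfl
        omega
      · exact i1 s h'
  have := this t le_rfl t le_rfl
  omega

theorem WW.consec {r t : ℕ} {z : ℕ → ℕ} (h : WW n C r t z) (hd : z t + 2 ≤ z 0 + 3 * t) :
    ∃ i k, i + 1 + k < t ∧ z (i+1) = z i + 2 ∧ (∀ s ≤ k, z (i+1+s) = z (i+1) + 3 * s) ∧
      z (i+1+k+1) = z (i+1+k) + 2 := by
  by_contra hc
  have : ∀ j ≤ t, z 0 + 3 * j ≤ z j ∨ (z j + 1 = z 0 + 3 * j ∧
      ∃ i k, i + 1 + k = j ∧ z (i+1) = z i + 2 ∧ ∀ s ≤ k, z (i+1+s) = z (i+1) + 3 * s) := by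
    intro j
    induction j with
    | zero => simp
    | succ j ih =>
      intro hj
      have st := h.2 j (by omega)
      have : z (j+1) = z j + 2 ∨ z (j+1) = z j + 3 ∨ z (j+1) = z j + 4 := by omega
      rcases ih (by omega) with h1 | ⟨h1, i, k, rfl, h2, h3⟩
      · rcases this with e | e | e
        · by_cases hz : z 0 + 3 * (j+1) ≤ z (j+1)
          · left; exact hz
          · right
            refine ⟨by omega, j, 0, by omega, e, ?_⟩
            intro s hs
            obtain rfl : s = 0 := by omega
            simp
        · left; omega
        · left; omega
      · rcases this with e | e | e
        · exact absurd ⟨i, k, by omega, h2, h3, e⟩ hc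
        · right
          refine ⟨by omega, i, k+1, by omega, h2, ?_⟩
          intro s hs
          rcases Nat.lt_or_ge k s with h' | h'
          · obtain rfl : s = k + 1 := by omega
            have := h3 k le_rfl
            have e5 : i + 1 + (k+1) = i + 1 + k + 1 := by omega
            rw [e5]; omega
          · exact h3 s h'
        · left; omega
  rcases this t le_rfl with h | h <;> omega

theorem HH.GW (H : HH m n C) (hn : 2 < n) {r t : ℕ} {z : ℕ → ℕ} (h1 : 1 ≤ r) (h2 : r + 1 ≤ m)
    (h : WW n C (r+1) t z) :
    ∃ u : ℕ → ℕ, ∀ s < t, C r (u s) = false ∧ z s + 1 ≤ u s ∧ u s ≤ z s + 2 ∧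
      z (s+1) ≤ u s + 2 ∧ u s + 1 ≤ z (s+1) := by
  have : ∀ s, ∃ u, s < t → C r u = false ∧ z s + 1 ≤ u ∧ u ≤ z s + 2 ∧
      z (s+1) ≤ u + 2 ∧ u + 1 ≤ z (s+1) := by
    intro s
    by_cases hs : s < t
    · obtain ⟨u, hu⟩ := H.G hn h1 h2 (h.1 s (by omega)).1 (h.1 (s+1) (by omega)).2.1
        (h.2 s hs).1 (h.2 s hs).2 (h.1 s (by omega)).2.2 (h.1 (s+1) (by omega)).2.2
      exact ⟨u, fun _ => hu⟩
    · exact ⟨0, fun h => absurd h hs⟩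
  choose u hu using this
  exact ⟨u, hu⟩

/-- walk with a deficit forces two more rows -/
theorem HH.rows (H : HH m n C) (hn : 2 < n) {r t : ℕ} {z : ℕ → ℕ} (h1 : 1 ≤ r) (h2 : r + 1 ≤ m)
    (h : WW n C (r+1) t z) (hd : z t < z 0 + 3 * t) : 2 ≤ r := by
  obtain ⟨s, hs, e⟩ := h.gap2 hd
  have a := h.1 s (by omega)
  have b := h.1 (s+1) (by omega)
  rw [e] at b
  exact (H.F hn h1 h2 (H.D2 (by omega) h2 a.1 b.2.1 a.2.2 b.2.2)).2.1

theorem HH.K (H : HH m n C) (hn : 2 < n) {r : ℕ} (h1 : 1 ≤ r) (h2 : r + 1 ≤ m)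
    (ih : ∀ r', 2 ≤ r' → r' < r → KP n C r') {a t : ℕ} (D1 : DD n C (r+1) a)
    (D2 : DD n C (r+1) (a+2+3*t)) (ch : ∀ s ≤ t, C (r+1) (a+1+3*s) = false) : False := by
  have F1 := H.F hn h1 h2 D1
  have F2 := H.F hn h1 h2 D2
  have bn := D2.2.1
  have a2 := D1.1
  obtain ⟨r, rfl⟩ : ∃ r', r = r' + 1 := ⟨r - 1, by omega⟩
  simp only [Nat.add_sub_cancel] at F1 F2
  have W : WW n C (r+1+1) t (fun s => a + 1 + 3 * s) :=
    ⟨fun s hs => ⟨by dsimp only; omega, by dsimp only; omega, ch s hs⟩,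
      fun s hs => ⟨by dsimp only; omega, by dsimp only; omega⟩⟩
  obtain ⟨u, hu⟩ := H.GW hn h1 h2 W
  try dsimp only at hu
  have Q : WW n C (r+1) (t+1) (fun s => if s = 0 then a else if s ≤ t then u (s-1) else a+2+3*t) := by
    constructor
    · intro s hs
      dsimp only
      split_ifs with c1 c2
      · exact ⟨by omega, by omega, F1.1⟩
      · have := hu (s-1) (by omega)
        exact ⟨by omega, by omega, this.1⟩
      · exact ⟨by omega, by omega, F2.1⟩
    · intro s hs
      dsimp only
      have e : s + 1 ≠ 0 := by omega
      rw [if_neg e]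
      have e' : s + 1 - 1 = s := by omega
      rw [e']
      have a2 := hu s
      have a1 := hu (s-1)
      rcases Nat.eq_zero_or_pos s with rfl | c0
      · simp only [if_true]
        split_ifs with c
        · have := a2 (by omega); omega
        · omega
      · rw [if_neg (by omega : s ≠ 0), if_pos (by omega : s ≤ t)]
        have := a1 (by omega)
        split_ifs with c
        · have := a2 (by omega); omega
        · omega
  have r2 : 2 ≤ r := by
    have := H.rows hn (r := r) (by omega) (by omega) Q (by simp; omega)
    exact this
  obtain ⟨v, hv⟩ := H.GW hn (by omega) (by omega) Q
  try dsimp only at hv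
  have v0 : v 0 = a + 2 := by
    have := hv 0 (by omega)
    simp only [if_true] at this
    have ne : v 0 ≠ a + 1 := by
      intro h; rw [h] at this; simp [F1] at this
    omega
  have vt : v t + 2 = a + 2 + 3 * t := by
    have := hv t (by omega)
    have e : t + 1 ≠ 0 := by omega
    have e1 : ¬ (t + 1 ≤ t) := by omega
    rw [if_neg e, if_neg e1] at this
    have ne : v t ≠ a + 2 + 3 * t - 1 := by
      intro h; have := this.1; rw [h, F2.2.2.1] at this; simp at this
    omega
  have V : WW n C r t v := by
    constructor
    · intro s hs
      have a1 := hv s (by omega)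
      have a2 := (Q.1 s (by omega))
      have a3 := (Q.1 (s+1) (by omega))
      dsimp only at a2 a3
      refine ⟨by omega, by omega, a1.1⟩
    · intro s hs
      have a1 := hv s (by omega)
      have a2 := hv (s+1) (by omega)
      omega
  have := ih r r2 (by omega) t v V
  omega

theorem HH.KPr (H : HH m n C) (hn : 2 < n) : ∀ r, 1 ≤ r → r + 1 ≤ m → KP n C (r+1) := by
  intro r
  induction r using Nat.strong_induction_on with
  | _ r ih =>
    intro h1 h2 t z W
    by_contra hc
    obtain ⟨i, k, g1, g2, g3, g4⟩ := W.consec (by omega)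
    have w0 := W.1 i (by omega)
    have w1 := W.1 (i+1) (by omega)
    have w2 := W.1 (i+1+k) (by omega)
    have w3 := W.1 (i+1+k+1) (by omega)
    have gk := g3 k le_rfl
    rw [g4] at w3
    rw [g2] at w1
    have D1 := H.D2 (by omega) h2 w0.1 w1.2.1 w0.2.2 w1.2.2
    have D2 := H.D2 (by omega) h2 w2.1 w3.2.1 w2.2.2 w3.2.2
    have e : z (i+1+k) + 1 = z i + 1 + 2 + 3 * k := by omega
    rw [e] at D2
    refine H.K hn h1 h2 ?_ D1 D2 ?_
    · intro r' q1 q2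
      obtain ⟨r', rfl⟩ : ∃ r'', r' = r'' + 1 := ⟨r' - 1, by omega⟩
      exact ih r' (by omega) (by omega) (by omega)
    · intro s hs
      have := g3 s hs
      have := (W.1 (i+1+s) (by omega)).2.2
      have e : z i + 1 + 1 + 3 * s = z (i+1+s) := by omega
      rw [e]; exact this

theorem HH.K2 (H : HH m n C) (hn : 2 < n) {r : ℕ} (h1 : 1 ≤ r) (h2 : r + 1 ≤ m)
    {a t : ℕ} (D1 : DD n C (r+1) a)
    (D2 : DD n C (r+1) (a+2+3*t)) (ch : ∀ s ≤ t, C (r+1) (a+1+3*s) = false) : False := by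
  refine H.K hn h1 h2 ?_ D1 D2 ch
  intro r' q1 q2
  obtain ⟨r', rfl⟩ : ∃ r'', r' = r'' + 1 := ⟨r' - 1, by omega⟩
  exact H.KPr hn r' (by omega) (by omega)

/-- walk from 3 has no deficit -/
theorem HH.EP (H : HH m n C) (hn : 2 < n) {r t : ℕ} {z : ℕ → ℕ} (h1 : 1 ≤ r) (h2 : r + 1 ≤ m)
    (W : WW n C (r+1) t z) (z0 : z 0 = 3) : z 0 + 3 * t ≤ z t := by
  by_contra hc
  rcases W.first (by omega) with ⟨i, hi, h⟩ | ⟨k, hk, h, h'⟩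
  · have := H.KPr hn r h1 h2 _ _ (W.suffix i hi)
    have e : i + (t - i) = t := by omega
    simp only [e] at this
    simp at this
    omega
  · have w0 := W.1 0 (by omega)
    rw [z0] at w0
    have w2 := W.1 k (by omega)
    have w3 := W.1 (k+1) (by omega)
    rw [h'] at w3
    have D2 := H.D2 (by omega) h2 w2.1 w3.2.1 w2.2.2 w3.2.2
    have e : z k + 1 = 2 + 2 + 3 * k := by have := h k le_rfl; omega
    rw [e] at D2
    have Z := H.z (r+1) 3 (by omega) h2 (by omega) (by omega) w0.2.2
    refine H.K2 hn h1 h2 (a := 2) ⟨by omega, by omega, Z.2.2.2.1, Or.inl rfl, Or.inr w0.2.2⟩ D2 ?_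
    intro s hs
    have := h s hs
    have w := (W.1 s (by omega)).2.2
    have e : 2 + 1 + 3 * s = z s := by omega
    rw [e]; exact w

theorem HH.B (H : HH m n C) (hn : 2 < n) {r : ℕ} (h1 : 1 ≤ r) (h2 : r + 1 ≤ m)
    (ih : ∀ r', 2 ≤ r' → r' < r → BP n C r') {k : ℕ}
    (D : DD n C (r+1) (3+3*k)) (ch : ∀ s ≤ k, C (r+1) (2+3*s) = false) : False := by
  have F := H.F hn h1 h2 D
  have bn := D.2.1
  rcases Nat.eq_zero_or_pos k with rfl | hk
  · omega
  obtain ⟨r, rfl⟩ : ∃ r', r = r' + 1 := ⟨r - 1, by omega⟩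
  simp only [Nat.add_sub_cancel] at F
  have W : WW n C (r+1+1) k (fun s => 2 + 3 * s) :=
    ⟨fun s hs => ⟨by dsimp only; omega, by dsimp only; omega, ch s hs⟩,
      fun s hs => ⟨by dsimp only; omega, by dsimp only; omega⟩⟩
  obtain ⟨u, hu⟩ := H.GW hn h1 h2 W
  try dsimp only at hu
  have Q : WW n C (r+1) k (fun s => if s < k then u s else 3+3*k) := by
    constructor
    · intro s hs
      dsimp only
      split_ifs with c1
      · have := hu s (by omega)
        exact ⟨by omega, by omega, this.1⟩
      · exact ⟨by omega, by omega, F.1⟩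
    · intro s hs
      dsimp only
      have a1 := hu s hs
      rw [if_pos hs]
      split_ifs with c1
      · have a2 := hu (s+1) c1
        omega
      · omega
  have u0 := hu 0 hk
  obtain ⟨w, hw⟩ := H.E hn (r := r) (p := u 0) (by omega) (by omega) (by omega) (by omega) u0.1
  have r2 : 2 ≤ r := by
    rcases Nat.lt_or_ge (u 0) 4 with h | h
    · have e : u 0 = 3 := by omega
      rw [e] at u0
      have Z := H.z (r+1) 3 (by omega) (by omega) (by omega) (by omega) u0.1
      exact (H.F hn (r := r) (a := 2) (by omega) (by omega)
        ⟨by omega, by omega, Z.2.2.2.1, Or.inl rfl, Or.inr u0.1⟩).2.1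
    · exact H.rows hn (r := r) (by omega) (by omega) Q (by simp [hk]; omega)
  obtain ⟨v, hv⟩ := H.GW hn (by omega) (by omega) Q
  try dsimp only at hv
  have vt : v (k-1) + 2 = 3 + 3 * k := by
    have := hv (k-1) (by omega)
    have e1 : ¬ (k - 1 + 1 < k) := by omega
    rw [if_neg e1] at this
    have ne : v (k-1) ≠ 3 + 3 * k - 1 := by
      intro h; have := this.1; rw [h, F.2.2.1] at this; simp at this
    omega
  have V : WW n C r k (fun s => if s = 0 then w else v (s-1)) := by
    constructor
    · intro s hs
      dsimp only
      split_ifs with c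
      · exact ⟨by omega, by omega, hw.1⟩
      · have a1 := hv (s-1) (by omega)
        have a2 := (Q.1 (s-1) (by omega))
        have a3 := (Q.1 (s-1+1) (by omega))
        dsimp only at a2 a3
        refine ⟨by omega, by omega, a1.1⟩
    · intro s hs
      have a2 := hv s (by omega)
      dsimp only
      have e : s + 1 ≠ 0 := by omega
      have e' : s + 1 - 1 = s := by omega
      rw [if_neg e, e']
      split_ifs with c
      · subst c
        rw [if_pos hk] at a2
        omega
      · have a1 := hv (s-1) (by omega)
        have e' : s - 1 + 1 = s := by omega
        rw [e'] at a1
        omega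
  have hk' : k ≠ 0 := by omega
  have : w = 2 ∨ w = 3 := by omega
  rcases this with rfl | rfl
  · have := ih r r2 (by omega) _ _ V (by simp)
    simp [hk'] at this
    omega
  · obtain ⟨r, rfl⟩ : ∃ r', r = r' + 1 := ⟨r - 1, by omega⟩
    have := H.EP hn (by omega) (by omega) V (by simp)
    simp [hk'] at this
    omega

theorem HH.BPr (H : HH m n C) (hn : 2 < n) : ∀ r, 1 ≤ r → r + 1 ≤ m → BP n C (r+1) := by
  intro r
  induction r using Nat.strong_induction_on with
  | _ r ih =>
    intro h1 h2 t z W z0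
    by_contra hc
    rcases W.first (by omega) with ⟨i, hi, h⟩ | ⟨k, hk, h, h'⟩
    · have := H.KPr hn r h1 h2 _ _ (W.suffix i hi)
      have e : i + (t - i) = t := by omega
      simp only [e] at this
      simp at this
      omega
    · have w2 := W.1 k (by omega)
      have w3 := W.1 (k+1) (by omega)
      rw [h'] at w3
      have D2 := H.D2 (by omega) h2 w2.1 w3.2.1 w2.2.2 w3.2.2
      have e : z k + 1 = 3 + 3 * k := by have := h k le_rfl; omega
      rw [e] at D2
      refine H.B hn h1 h2 ?_ D2 ?_
      · intro r' q1 q2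
        obtain ⟨r', rfl⟩ : ∃ r'', r' = r'' + 1 := ⟨r' - 1, by omega⟩
        exact ih r' (by omega) (by omega) (by omega)
      · intro s hs
        have := h s hs
        have w := (W.1 s (by omega)).2.2
        have e : 2 + 3 * s = z s := by omega
        rw [e]; exact w

theorem HH.B2 (H : HH m n C) (hn : 2 < n) {r : ℕ} (h1 : 1 ≤ r) (h2 : r + 1 ≤ m) {k : ℕ}
    (D : DD n C (r+1) (3+3*k)) (ch : ∀ s ≤ k, C (r+1) (2+3*s) = false) : False := by
  refine H.B hn h1 h2 ?_ D ch
  intro r' q1 q2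
  obtain ⟨r', rfl⟩ : ∃ r'', r' = r'' + 1 := ⟨r' - 1, by omega⟩
  exact H.BPr hn r' (by omega) (by omega)
end

section
variable {m n : ℕ} {C : ℕ → ℕ → Bool}

theorem HH.chain (H : HH m n C) {r x : ℕ} (h2 : r + 1 + 1 = m) (hx : 2 ≤ x)
    (hxn : x ≤ n) (zx : C (r+1) x = false)
    (no : ∀ k, (∀ s ≤ k, C (r+1) (x+3*s) = false) → ¬ DD n C (r+1) (x+3*k+1)) :
    ∃ k, x + 3 * k + 1 = n ∧ ∀ s ≤ k, C (r+1) (x+3*s) = false := by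
  by_contra hc
  push Not at hc
  have key : ∀ k, x + 3 * k ≤ n ∧ ∀ s ≤ k, C (r+1) (x+3*s) = false := by
    intro k
    induction k with
    | zero =>
      refine ⟨by omega, ?_⟩
      intro s hs
      obtain rfl : s = 0 := by omega
      simpa using zx
    | succ k ih =>
      obtain ⟨a, b⟩ := ih
      have Z := H.z (r+1) (x+3*k) (by omega) (by omega) (by omega) a (b k le_rfl)
      have n1 : x + 3 * k + 1 ≠ n := by
        intro h
        obtain ⟨s, hs, h'⟩ := hc k h
        exact h' (b s hs)
      have nd := no k b
      unfold DD at nd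
      have e1 : x + 3 * k + 1 - 1 = x + 3 * k := by omega
      rw [e1] at nd
      have nd' : ¬ (x + 3 * k + 1 + 1 = n ∨ C (r+1) (x+3*k+1+1) = false) := by
        intro h
        exact nd ⟨by omega, by omega, Z.2.2.2.2.1, Or.inr (b k le_rfl), h⟩
      push Not at nd'
      have S : C (r+1+1) (x+3*k+1+1) = true := by
        by_contra hS
        have := H.z (r+1+1) (x+3*k+1+1) (by omega) (by omega) (by omega) (by omega) (by simpa using hS)
        omega
      have P := H.p (r+1) (x+3*k+1+1) (by omega) (by omega) (by omega) (by omega) (by simpa using nd'.2)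
      simp [S, Z] at P
      refine ⟨by omega, ?_⟩
      intro s hs
      rcases Nat.lt_or_ge k s with h' | h'
      · obtain rfl : s = k + 1 := by omega
        exact P
      · exact b s h'
  have := (key n).1
  omega

theorem HH.base (H : HH m n C) (hn : 2 < n) {r : ℕ} (h1 : 1 ≤ r) (h2 : r + 1 + 1 = m) :
    ∃ k, n = 3 * k + 3 ∧ ∀ s ≤ k, C (r+1) (2+3*s) = false := by
  have z2 : C (r+1) 2 = false := by
    by_contra hc
    have hc : C (r+1) 2 = true := by simpa using hc
    have S : C (r+1+1) 2 = true := by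
      by_contra hS
      have := H.z (r+1+1) 2 (by omega) (by omega) (by omega) (by omega) (by simpa using hS)
      omega
    have z3 := H.p (r+1) 2 (by omega) (by omega) (by omega) (by omega) hc
    simp [S, H.edge1 (i := r+1) (by omega) (by omega) hn] at z3
    have Z3 := H.z (r+1) 3 (by omega) (by omega) (by omega) (by omega) z3
    have D : DD n C (r+1) 2 := ⟨by omega, by omega, hc, Or.inl rfl, Or.inr z3⟩
    obtain ⟨k, hk, ch⟩ := H.chain h2 (x := 3) (by omega) (by omega) z3 (by
      intro k ch D2
      have e : 3 + 3 * k + 1 = 2 + 2 + 3 * k := by omega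
      rw [e] at D2
      exact H.K2 hn h1 (by omega) D D2 (by simpa using ch))
    have H' := H.mir
    refine H'.B2 hn h1 (by omega) (k := k) ?_ ?_
    · refine ⟨by omega, by omega, ?_, Or.inr ?_, Or.inl (by omega)⟩
      · have : n + 1 - (3 + 3 * k) = 2 := by omega
        simp only [this]; exact hc
      · have : n + 1 - (3 + 3 * k - 1) = 3 := by omega
        simp only [this]; exact z3
    · intro s hs
      have : n + 1 - (2 + 3 * s) = 3 + 3 * (k - s) := by omega
      simp only [this]
      exact ch _ (by omega)
  obtain ⟨k, hk, ch⟩ := H.chain h2 (x := 2) (by omega) (by omega) z2 (by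
      intro k ch D2
      have e : 2 + 3 * k + 1 = 3 + 3 * k := by omega
      rw [e] at D2
      exact H.B2 hn h1 (by omega) D2 ch)
  exact ⟨k, by omega, ch⟩

theorem HH.step (H : HH m n C) (hn : 2 < n) {r t : ℕ} (h1 : 1 ≤ r) (h2 : r + 1 + 1 ≤ m)
    (ht : n = 3 * t + 3) (ch : ∀ s ≤ t, C (r+1+1) (2+3*s) = false) :
    ∀ s ≤ t, C r (2+3*s) = false := by
  rcases Nat.eq_zero_or_pos t with rfl | hk
  · intro s hs
    obtain rfl : s = 0 := by omega
    have U := H.up (i := r+1) (by omega) h2 (by omega) (by omega) (ch 0 (by omega))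
    by_contra hc
    have := H.p r 2 h1 (by omega) (by omega) (by omega) (by simpa using hc)
    have e1 := H.edge1 h1 (by omega) hn
    have e2 := H.edgen h1 (by omega) hn
    simp at U
    subst ht
    simp at e2
    simp [U, e1, e2] at this
  have W : WW n C (r+1+1) t (fun s => 2 + 3 * s) :=
    ⟨fun s hs => ⟨by dsimp only; omega, by dsimp only; omega, ch s hs⟩,
      fun s hs => ⟨by dsimp only; omega, by dsimp only; omega⟩⟩
  obtain ⟨q, hq⟩ := H.GW hn (by omega) h2 W
  have Q : WW n C (r+1) (t-1) q := by
    constructor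
    · intro s hs
      have := hq s (by omega)
      exact ⟨by omega, by omega, this.1⟩
    · intro s hs
      have a1 := hq s (by omega)
      have a2 := hq (s+1) (by omega)
      omega
  have q0 := hq 0 hk
  have qt := hq (t-1) (by omega)
  obtain ⟨w, hw⟩ := H.E hn (r := r) (p := q 0) (by omega) (by omega) (by omega) (by omega) q0.1
  have H' := H.mir
  have ee : n + 1 - (n + 1 - q (t-1)) = q (t-1) := by omega
  obtain ⟨w', hw'⟩ := H'.E hn (r := r) (p := n + 1 - q (t-1)) (by omega) (by omega) (by omega) (by omega)
    (by simp only [ee]; exact qt.1)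
  have r2 : 2 ≤ r := by
    by_cases h : q 0 = 3
    · rw [h] at q0
      have Z := H.z (r+1) 3 (by omega) (by omega) (by omega) (by omega) q0.1
      exact (H.F hn (r := r) (a := 2) (by omega) (by omega)
        ⟨by omega, by omega, Z.2.2.2.1, Or.inl rfl, Or.inr q0.1⟩).2.1
    by_cases h' : q (t-1) + 2 = n
    · have Z := H.z (r+1) (q (t-1)) (by omega) (by omega) (by omega) (by omega) qt.1
      exact (H.F hn (r := r) (a := q (t-1) + 1) (by omega) (by omega)
        ⟨by omega, by omega, Z.2.2.2.2.1, Or.inr (by simpa using qt.1), Or.inl (by omega)⟩).2.1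
    · exact H.rows hn (r := r) (by omega) (by omega) Q (by omega)
  obtain ⟨v, hv⟩ := H.GW hn (by omega) (by omega) Q
  let y : ℕ → ℕ := fun s => if s = 0 then w else if s < t then v (s-1) else n + 1 - w'
  have y0 : y 0 = w := by simp [y]
  have yt : y t = n + 1 - w' := by
    have : t ≠ 0 := by omega
    simp [y, this]
  have ym : ∀ s, 1 ≤ s → s < t → y s = v (s-1) := by
    intro s h h'
    have : s ≠ 0 := by omega
    simp [y, this, h']
  have Y1 : ∀ s < t, y s + 1 ≤ q s ∧ q s ≤ y s + 2 ∧ q s + 1 ≤ y (s+1) ∧ y (s+1) ≤ q s + 2 := by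
    intro s hs
    have A : y s + 1 ≤ q s ∧ q s ≤ y s + 2 := by
      rcases Nat.eq_zero_or_pos s with rfl | h
      · omega
      · have a := hv (s-1) (by omega)
        have e : s - 1 + 1 = s := by omega
        rw [e] at a
        rw [ym s h hs]
        omega
    have B : q s + 1 ≤ y (s+1) ∧ y (s+1) ≤ q s + 2 := by
      rcases Nat.lt_or_ge (s+1) t with h | h
      · have a := hv s (by omega)
        rw [ym (s+1) (by omega) h]
        simp only [Nat.add_sub_cancel]
        omega
      · obtain rfl : t = s + 1 := by omega
        simp only [Nat.add_sub_cancel] at hw' qt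
        omega
    omega
  have Y : WW n C r t y := by
    constructor
    · intro s hs
      rcases Nat.eq_zero_or_pos s with rfl | h
      · rw [y0]; exact ⟨by omega, by omega, hw.1⟩
      · rcases Nat.lt_or_ge s t with h' | h'
        · rw [ym s h h']
          have a := hv (s-1) (by omega)
          have b := Q.1 (s-1) (by omega)
          have b' := Q.1 (s-1+1) (by omega)
          exact ⟨by omega, by omega, a.1⟩
        · obtain rfl : s = t := by omega
          rw [yt]
          exact ⟨by omega, by omega, hw'.1⟩
    · intro s hs
      have a := Y1 s hs
      rcases Nat.lt_or_ge (s+1) t with h | h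
      · have := Y1 (s+1) h
        have := hq s (by omega)
        omega
      · omega
  obtain ⟨r, rfl⟩ : ∃ r', r = r' + 1 := ⟨r - 1, by omega⟩
  have w2 : w = 2 := by
    by_contra hc
    have := H.EP hn (by omega) (by omega) Y (by omega)
    omega
  have lo : ∀ s ≤ t, 2 + 3 * s ≤ y s := by
    intro s hs
    have := H.BPr hn r (by omega) (by omega) _ _ (Y.pre s hs) (by omega)
    omega
  have yt' : y t = 2 + 3 * t := by
    have := lo t le_rfl
    omega
  have Y' : WW n (fun i j => C i (n + 1 - j)) (r+1) t (fun s => n + 1 - y (t - s)) := by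
    constructor
    · intro s hs
      have a := Y.1 (t - s) (by omega)
      have e : n + 1 - (n + 1 - y (t - s)) = y (t - s) := by omega
      simp only [e]
      exact ⟨by omega, by omega, a.2.2⟩
    · intro s hs
      have a := Y.2 (t - (s+1)) (by omega)
      have e : t - (s + 1) + 1 = t - s := by omega
      rw [e] at a
      have b := Y.1 (t - s) (by omega)
      dsimp only
      omega
  intro s hs
  have hi := H'.BPr hn r (by omega) (by omega) _ _ (Y'.pre (t-s) (by omega)) (by simp; omega)
  have e : t - (t - s) = s := by omega
  simp only [e] at hi
  simp at hi
  have l := lo s hs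
  have a := Y.1 s hs
  have e : 2 + 3 * s = y s := by omega
  rw [e]
  exact a.2.2
end

/-- in an `m × n` ES configuration with `m, n > 2`, `3 ∣ n` and every
row `m - 1 - 2k` (which is present) equals the pattern `101 101 … 101`. -/
theorem stmt18 (m n : ℕ) (hm : 2 < m) (hn : 2 < n) (C : ℕ → ℕ → Bool)
    (hmax : IsMaximal2 m n C) (hp : ResistPred2 m n C) (ha : ResistAlt2 m n C) :
    3 ∣ n ∧ ∀ k : ℕ, 1 ≤ m - 1 - 2 * k →
      ∀ j, 1 ≤ j → j ≤ n → (C (m - 1 - 2 * k) j = false ↔ j % 3 = 2) := by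
  have H := HH.of m n C hmax hp ha
  obtain ⟨r, rfl⟩ : ∃ r, m = r + 1 + 1 := ⟨m - 2, by omega⟩
  obtain ⟨t, ht, ch⟩ := H.base hn (r := r) (by omega) rfl
  refine ⟨⟨t + 1, by omega⟩, ?_⟩
  have all : ∀ k : ℕ, 1 ≤ r + 1 + 1 - 1 - 2 * k →
      ∀ s ≤ t, C (r + 1 + 1 - 1 - 2 * k) (2 + 3 * s) = false := by
    intro k
    induction k with
    | zero => intro _; simpa using ch
    | succ k ih =>
      intro h
      have e : r + 1 + 1 - 1 - 2 * k = (r + 1 + 1 - 1 - 2 * (k+1)) + 1 + 1 := by omega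
      rw [e] at ih
      exact H.step hn h (by omega) ht (ih (by omega))
  intro k hk j hj hjn
  have A := all k hk
  generalize hR : r + 1 + 1 - 1 - 2 * k = R at *
  constructor
  · intro hz
    have Z := H.z R j hk (by omega) hj hjn hz
    by_contra hc
    have : j % 3 = 0 ∨ j % 3 = 1 := by omega
    rcases this with h | h
    · have a := A (j / 3 - 1) (by omega)
      have e : 2 + 3 * (j / 3 - 1) = j - 1 := by omega
      rw [e] at a
      simp [a] at Z
    · have a := A (j / 3) (by omega)
      have e : 2 + 3 * (j / 3) = j + 1 := by omega
      rw [e] at a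
      simp [a] at Z
  · intro h
    have a := A (j / 3) (by omega)
    have e : 2 + 3 * (j / 3) = j := by omega
    rwa [e] at a
end
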